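/- arXiv:1103.4672 — 9 statements merged into one kernel-verified Lean document; each statement's English description precedes it below -/
import Mathlib

section
/- Let p be a prime and let n = p^k·m with m prime to p. For γ ∈ ℚ/ℤ, let γ₁ ∈ μ^(p) denote its prime-to-p component. Then the set S = {z ∈ μ^(p) : n·z = γ₁} has exactly m elements, and r(ρ̃_n(e(γ))) = p^k · ∑_{z ∈ S} e(z) in ℤ[μ^(p)]. -/
open scoped BigOperators

/-- The subgroup `μ^(p) ⊂ ℚ/ℤ` of elements of order prime to `p`. -/
def primeToP (p : ℕ) : AddSubgroup (AddCircle (1 : ℚ)) where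
  carrier := {x | ∃ m : ℕ, Nat.Coprime m p ∧ m • x = 0}
  zero_mem' := ⟨1, Nat.coprime_one_left p, smul_zero 1⟩
  add_mem' := by
    rintro a b ⟨m, hm, ha⟩ ⟨k, hk, hb⟩
    refine ⟨m * k, hm.mul hk, ?_⟩
    have h1 : (m * k) • a = 0 := by rw [mul_comm, mul_smul, ha, smul_zero]
    have h2 : (m * k) • b = 0 := by rw [mul_smul, hb, smul_zero]
    rw [smul_add, h1, h2, add_zero]
  neg_mem' := by
    rintro a ⟨m, hm, ha⟩
    exact ⟨m, hm, by rw [smul_neg, ha, neg_zero]⟩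

/-- The `p`-primary torsion subgroup `μ_{p^∞} ⊂ ℚ/ℤ`. -/
def pPrimary (p : ℕ) : AddSubgroup (AddCircle (1 : ℚ)) where
  carrier := {x | ∃ k : ℕ, p ^ k • x = 0}
  zero_mem' := ⟨0, smul_zero _⟩
  add_mem' := by
    rintro a b ⟨k, ha⟩ ⟨l, hb⟩
    refine ⟨k + l, ?_⟩
    have h1 : p ^ (k + l) • a = 0 := by
      rw [pow_add, mul_comm, mul_smul, ha, smul_zero]
    have h2 : p ^ (k + l) • b = 0 := by
      rw [pow_add, mul_smul, hb, smul_zero]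
    rw [smul_add, h1, h2, add_zero]
  neg_mem' := by
    rintro a ⟨k, ha⟩
    exact ⟨k, by rw [smul_neg, ha, neg_zero]⟩

theorem AddCircle.coe_eq_coe_iff_exists_int {a b : ℚ} :
    (a : AddCircle (1 : ℚ)) = b ↔ ∃ j : ℤ, a = b + j := by
  rw [← sub_eq_zero, ← AddCircle.coe_sub, AddCircle.coe_eq_zero_iff]
  refine exists_congr fun j => ?_
  rw [zsmul_one, eq_sub_iff_add_eq, add_comm, eq_comm]

/-- In `ℚ/ℤ`, division by `n ≠ 0` has exactly `n` solutions. -/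
theorem finite_and_ncard_nsmul_eq {n : ℕ} (hn : n ≠ 0) (δ : AddCircle (1 : ℚ)) :
    {x : AddCircle (1 : ℚ) | n • x = δ}.Finite ∧
      {x : AddCircle (1 : ℚ) | n • x = δ}.ncard = n := by
  induction δ using QuotientAddGroup.induction_on with | _ q
  have hn' : (n : ℚ) ≠ 0 := Nat.cast_ne_zero.mpr hn
  have himage : {x : AddCircle (1 : ℚ) | n • x = (q : AddCircle (1 : ℚ))} =
      (fun i : ℕ => (((q + i) / n : ℚ) : AddCircle (1 : ℚ))) '' (Finset.range n : Set ℕ) := by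
    ext x
    constructor
    · intro hx
      induction x using QuotientAddGroup.induction_on with | _ t
      have hx' : ((n • t : ℚ) : AddCircle (1 : ℚ)) = (q : AddCircle (1 : ℚ)) := hx
      obtain ⟨j, hj⟩ := AddCircle.coe_eq_coe_iff_exists_int.1 hx'
      have hpos : (0 : ℤ) < n := by omega
      refine ⟨(j % n).toNat, ?_, ?_⟩
      · have := Int.emod_lt_of_pos j hpos
        have := Int.emod_nonneg j hpos.ne'
        simp only [Finset.coe_range, Set.mem_Iio]
        omega
      · refine AddCircle.coe_eq_coe_iff_exists_int.2 ⟨-(j / n), ?_⟩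
        have h1 : (((j % n).toNat : ℕ) : ℤ) = j - n * (j / n) := by
          rw [Int.toNat_of_nonneg (Int.emod_nonneg j hpos.ne'), Int.emod_def]
        have h2 : (((j % n).toNat : ℕ) : ℚ) = j - n * ((j / n : ℤ) : ℚ) := by exact_mod_cast h1
        rw [h2]
        rw [nsmul_eq_mul] at hj
        push_cast
        rw [div_eq_iff hn']
        linarith
    · rintro ⟨i, -, rfl⟩
      change ((n • ((q + i) / n) : ℚ) : AddCircle (1 : ℚ)) = (q : AddCircle (1 : ℚ))
      refine AddCircle.coe_eq_coe_iff_exists_int.2 ⟨i, ?_⟩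
      rw [nsmul_eq_mul, mul_div_cancel₀ _ hn', Int.cast_natCast]
  have hinj : Set.InjOn (fun i : ℕ => (((q + i) / n : ℚ) : AddCircle (1 : ℚ)))
      (Finset.range n : Set ℕ) := by
    intro i hi i' hi' h
    obtain ⟨j, hj⟩ := AddCircle.coe_eq_coe_iff_exists_int.1 h
    rw [div_add' _ _ _ hn', div_left_inj' hn'] at hj
    have h1 : (i : ℤ) = i' + j * n := by
      have : (i : ℚ) = i' + j * n := by linarith
      exact_mod_cast this
    have h2 : i ≡ i' [MOD n] := by
      rw [← Int.natCast_modEq_iff, h1]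
      simp [Int.ModEq]
    exact h2.eq_of_lt_of_lt (Finset.mem_range.1 hi) (Finset.mem_range.1 hi')
  rw [himage]
  refine ⟨(Finset.finite_toSet _).image _, ?_⟩
  rw [hinj.ncard_image, Set.ncard_coe_finset, Finset.card_range]

theorem exists_zsmul_add_zsmul_eq_of_coprime {A : Type*} [AddCommGroup A] {a b : ℕ}
    (h : Nat.Coprime a b) : ∃ u v : ℤ, ∀ x : A, u • a • x + v • b • x = x := by
  obtain ⟨u, v, huv⟩ := Nat.isCoprime_iff_coprime.2 h
  refine ⟨u, v, fun x => ?_⟩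
  rw [← natCast_zsmul, ← natCast_zsmul, smul_smul, smul_smul, ← add_smul, huv, one_smul]

theorem eq_zero_of_mem_primeToP_of_pow_nsmul_eq_zero {p l : ℕ} {x : AddCircle (1 : ℚ)}
    (hx : x ∈ primeToP p) (hl : p ^ l • x = 0) : x = 0 := by
  obtain ⟨c, hc, hcx⟩ := hx
  obtain ⟨u, v, huv⟩ :=
    exists_zsmul_add_zsmul_eq_of_coprime (A := AddCircle (1 : ℚ)) (hc.pow_right l)
  rw [← huv x, hcx, hl, smul_zero, smul_zero, add_zero]

theorem ncard_primeToP_nsmul_eq {p : ℕ} (k : ℕ) {m : ℕ} (hm₀ : m ≠ 0) (hm : Nat.Coprime m p)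
    (γ₁ : primeToP p) : {z : primeToP p | (p ^ k * m) • z = γ₁}.ncard = m := by
  refine (Set.ncard_congr (s := {z : primeToP p | (p ^ k * m) • z = γ₁})
    (t := {w : AddCircle (1 : ℚ) | m • w = γ₁})
    (fun z _ => p ^ k • (z : AddCircle (1 : ℚ))) ?_ ?_ ?_).trans
    (finite_and_ncard_nsmul_eq hm₀ _).2
  · intro z hz
    change m • p ^ k • (z : AddCircle (1 : ℚ)) = γ₁
    rw [smul_smul, mul_comm]
    exact congrArg Subtype.val hz
  · intro z z' _ _ h
    refine Subtype.ext (sub_eq_zero.1 ?_)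
    refine eq_zero_of_mem_primeToP_of_pow_nsmul_eq_zero (l := k) (sub_mem z.2 z'.2) ?_
    rw [smul_sub, sub_eq_zero]
    exact h
  · intro w hw
    obtain ⟨c, hc, hcγ⟩ := γ₁.2
    have hw' : m • w = γ₁ := hw
    have hcw : (c * m) • w = 0 := by rw [mul_smul, hw', hcγ]
    have hwmem : w ∈ primeToP p := ⟨c * m, hc.mul_left hm, hcw⟩
    obtain ⟨u, v, huv⟩ := exists_zsmul_add_zsmul_eq_of_coprime (A := AddCircle (1 : ℚ))
      ((hc.mul_left hm).pow_right k)
    have hv : p ^ k • v • w = w := by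
      rw [smul_comm]
      simpa only [hcw, smul_zero, zero_add] using huv w
    refine ⟨v • ⟨w, hwmem⟩, Subtype.ext ?_, hv⟩
    change (p ^ k * m) • v • w = γ₁
    rw [mul_comm, mul_smul, hv, hw']

theorem bijOn_add_primeToP_pPrimary {p k m : ℕ} (hm : Nat.Coprime m p)
    (γ₁ : primeToP p) (γ₂ : pPrimary p) :
    Set.BijOn (fun w : primeToP p × pPrimary p =>
        (w.1 : AddCircle (1 : ℚ)) + (w.2 : AddCircle (1 : ℚ)))
      ({z : primeToP p | (p ^ k * m) • z = γ₁} ×ˢ {y : pPrimary p | (p ^ k * m) • y = γ₂})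
      {x : AddCircle (1 : ℚ) | (p ^ k * m) • x = γ₁ + γ₂} := by
  have hunique : ∀ a b : primeToP p × pPrimary p,
      (a.1 : AddCircle (1 : ℚ)) + (a.2 : AddCircle (1 : ℚ)) =
        (b.1 : AddCircle (1 : ℚ)) + (b.2 : AddCircle (1 : ℚ)) → a = b := by
    rintro ⟨a₁, a₂⟩ ⟨b₁, b₂⟩ h
    have hsub : (a₁ - b₁ : AddCircle (1 : ℚ)) = b₂ - a₂ := by
      rw [sub_eq_sub_iff_add_eq_add, add_comm (b₂ : AddCircle (1 : ℚ))]
      exact h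
    obtain ⟨l, hl⟩ : (b₂ - a₂ : AddCircle (1 : ℚ)) ∈ pPrimary p := sub_mem b₂.2 a₂.2
    have h0 : (a₁ - b₁ : AddCircle (1 : ℚ)) = 0 :=
      eq_zero_of_mem_primeToP_of_pow_nsmul_eq_zero (sub_mem a₁.2 b₁.2) (hsub ▸ hl)
    exact Prod.ext (Subtype.ext (sub_eq_zero.1 h0))
      (Subtype.ext (sub_eq_zero.1 (hsub ▸ h0)).symm)
  refine ⟨?_, fun a _ b _ h => hunique a b h, ?_⟩
  · rintro ⟨z, y⟩ ⟨hz, hy⟩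
    have hz' := congrArg Subtype.val hz
    have hy' := congrArg Subtype.val hy
    change (p ^ k * m) • ((z : AddCircle (1 : ℚ)) + y) = γ₁ + γ₂
    rw [smul_add]
    exact congrArg₂ (· + ·) hz' hy'
  · intro x hx
    have hx' : (p ^ k * m) • x = γ₁ + γ₂ := hx
    obtain ⟨c, hc, hcγ⟩ := γ₁.2
    obtain ⟨l, hlγ⟩ := γ₂.2
    have hx0 : (c * m) • p ^ (l + k) • x = 0 := by
      have h1 : (c * m) • p ^ (l + k) • x = (c * p ^ l) • (p ^ k * m) • x := by
        rw [smul_smul, smul_smul]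
        congr 1
        ring
      rw [h1, hx', smul_add, mul_smul c _ (γ₂ : AddCircle (1 : ℚ)), hlγ, mul_comm, mul_smul, hcγ]
      simp only [smul_zero, add_zero]
    obtain ⟨u, v, huv⟩ := exists_zsmul_add_zsmul_eq_of_coprime (A := AddCircle (1 : ℚ))
      ((hc.mul_left hm).pow_right (l + k))
    let z : primeToP p := v • ⟨p ^ (l + k) • x, c * m, hc.mul_left hm, hx0⟩
    let y : pPrimary p := u • ⟨(c * m) • x, l + k, by rw [smul_comm]; exact hx0⟩
    have hzy : (z : AddCircle (1 : ℚ)) + y = x := by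
      rw [add_comm]
      exact huv x
    have h := hunique ((p ^ k * m) • z, (p ^ k * m) • y) (γ₁, γ₂) (by
      change (p ^ k * m) • (z : AddCircle (1 : ℚ)) + (p ^ k * m) • (y : AddCircle (1 : ℚ)) = _
      rw [← smul_add, hzy, hx'])
    exact ⟨(z, y), ⟨congrArg Prod.fst h, congrArg Prod.snd h⟩, hzy⟩

/-- the projection of `ρ̃_n(e(γ))` to `ℤ[μ^(p)]`. -/
theorem stmt1 (p : ℕ) (hp : p.Prime) (k m n : ℕ) (hm : Nat.Coprime m p)
    (hn : n = p ^ k * m)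
    (γ : AddCircle (1 : ℚ)) (γ₁ : ↥(primeToP p)) (γ₂ : ↥(pPrimary p))
    (hγ : γ = (γ₁ : AddCircle (1 : ℚ)) + (γ₂ : AddCircle (1 : ℚ)))
    (r : AddMonoidAlgebra ℤ (AddCircle (1 : ℚ)) →+* AddMonoidAlgebra ℤ ↥(primeToP p))
    (hr : ∀ (a : ↥(primeToP p)) (b : ↥(pPrimary p)),
      r (AddMonoidAlgebra.single ((a : AddCircle (1 : ℚ)) + (b : AddCircle (1 : ℚ))) 1)
        = AddMonoidAlgebra.single a 1)
    (ρn : AddMonoidAlgebra ℤ (AddCircle (1 : ℚ)) →+ AddMonoidAlgebra ℤ (AddCircle (1 : ℚ)))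
    (hρn : ∀ δ : AddCircle (1 : ℚ),
      ρn (AddMonoidAlgebra.single δ 1)
        = ∑ᶠ δ' ∈ {δ' : AddCircle (1 : ℚ) | n • δ' = δ}, AddMonoidAlgebra.single δ' (1 : ℤ)) :
    {z : ↥(primeToP p) | n • z = γ₁}.Finite ∧
    {z : ↥(primeToP p) | n • z = γ₁}.ncard = m ∧
    r (ρn (AddMonoidAlgebra.single γ 1))
      = (p ^ k : ℤ) • ∑ᶠ z ∈ {z : ↥(primeToP p) | n • z = γ₁},
          AddMonoidAlgebra.single z (1 : ℤ) := by
  subst hn hγ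
  have hm₀ : m ≠ 0 := by
    rintro rfl
    exact hp.one_lt.ne' ((Nat.coprime_zero_left p).1 hm)
  have hn₀ : p ^ k * m ≠ 0 := mul_ne_zero (pow_ne_zero k hp.ne_zero) hm₀
  have hS : {z : primeToP p | (p ^ k * m) • z = γ₁}.Finite :=
    Set.Finite.of_finite_image ((finite_and_ncard_nsmul_eq hn₀ (γ₁ : AddCircle (1 : ℚ))).1.subset
      (by rintro _ ⟨z, hz, rfl⟩; exact congrArg Subtype.val hz)) Subtype.val_injective.injOn
  have hT : {y : pPrimary p | (p ^ k * m) • y = γ₂}.Finite :=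
    Set.Finite.of_finite_image ((finite_and_ncard_nsmul_eq hn₀ (γ₂ : AddCircle (1 : ℚ))).1.subset
      (by rintro _ ⟨y, hy, rfl⟩; exact congrArg Subtype.val hy)) Subtype.val_injective.injOn
  have hbij := bijOn_add_primeToP_pPrimary (k := k) hm γ₁ γ₂
  have hScard := ncard_primeToP_nsmul_eq k hm₀ hm γ₁
  have hcard := (finite_and_ncard_nsmul_eq hn₀ ((γ₁ : AddCircle (1 : ℚ)) + γ₂)).2
  refine ⟨hS, hScard, ?_⟩
  rw [← hbij.image_eq, hbij.injOn.ncard_image, Set.ncard_prod, hScard, mul_comm,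
    Nat.mul_left_inj hm₀] at hcard
  rw [hρn, ← hbij.image_eq, finsum_mem_image hbij.injOn]
  generalize {z : primeToP p | (p ^ k * m) • z = γ₁} = S at *
  generalize {y : pPrimary p | (p ^ k * m) • y = γ₂} = T at *
  lift S to Finset (primeToP p) using hS
  lift T to Finset (pPrimary p) using hT
  rw [Set.ncard_coe_finset] at hcard
  rw [← Finset.coe_product, finsum_mem_coe_finset, finsum_mem_coe_finset, map_sum,
    Finset.sum_product, Finset.smul_sum]
  refine Finset.sum_congr rfl fun z _ => ?_
  rw [Finset.sum_congr rfl fun y _ => hr z y, Finset.sum_const, hcard, ← natCast_zsmul,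
    Nat.cast_pow]
end

section
/- Let p be a prime. For every x ∈ ℤ[ℚ/ℤ] and every positive integer n one has r(ρ̃_n(x)) = r(ρ̃_n(j(r(x)))), where j : ℤ[μ^(p)] → ℤ[ℚ/ℤ] is the canonical inclusion. Moreover, for every nonnegative integer k, σ_{p^k} restricts to a ring automorphism of ℤ[μ^(p)] and σ_{p^k}(r(ρ̃_{p^k}(x))) = p^k · r(x) for all x ∈ ℤ[ℚ/ℤ]; equivalently, r ∘ ρ̃_{p^k} = p^k · σ_{p^k}^{-1} ∘ r on ℤ[ℚ/ℤ]. -/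
open scoped BigOperators

theorem AddMonoidAlgebra.addHom_ext_int {M B : Type*} [AddCommGroup B]
    {f g : AddMonoidAlgebra ℤ M →+ B}
    (h : ∀ a, f (AddMonoidAlgebra.single a 1) = g (AddMonoidAlgebra.single a 1)) : f = g := by
  ext a : 1
  exact AddMonoidHom.ext_int (by simpa using h a)

namespace AddCircle

theorem exists_pos_nsmul_eq_zero (x : AddCircle (1 : ℚ)) : ∃ n : ℕ, 0 < n ∧ n • x = 0 := by
  induction x using QuotientAddGroup.induction_on with
  | H q =>
    refine ⟨q.den, q.den_pos, ?_⟩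
    rw [← AddCircle.coe_nsmul, AddCircle.coe_eq_zero_iff]
    exact ⟨q.num, by simp⟩

theorem exists_nsmul_eq {n : ℕ} (hn : 0 < n) (x : AddCircle (1 : ℚ)) : ∃ y, n • y = x :=
  ⟨DivisibleBy.div x (n : ℤ), by
    simpa using DivisibleBy.div_cancel (n := (n : ℤ)) x (by exact_mod_cast hn.ne')⟩

theorem ncard_torsion {n : ℕ} (hn : 0 < n) :
    {x : AddCircle (1 : ℚ) | n • x = 0}.ncard = n := by
  have : Fact ((0 : ℚ) < 1) := ⟨one_pos⟩
  have hfin := finite_torsion (1 : ℚ) hn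
  apply le_antisymm
  · have h := card_torsion_le_of_isSMulRegular (1 : ℚ) n hn.ne'
      (.of_right_eq_zero_of_smul fun _ ↦ by simp [hn.ne'])
    rw [← hfin.cast_ncard_eq] at h
    exact_mod_cast h
  · have hord : addOrderOf ((1 / n : ℚ) : AddCircle (1 : ℚ)) = n := addOrderOf_period_div hn
    calc n = (AddSubgroup.zmultiples ((1 / n : ℚ) : AddCircle (1 : ℚ)) :
          Set (AddCircle (1 : ℚ))).ncard := by
            rw [← Nat.card_coe_set_eq]
            exact hord.symm.trans (Nat.card_zmultiples _).symm
      _ ≤ _ := by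
        refine Set.ncard_le_ncard ?_ hfin
        rintro _ ⟨m, rfl⟩
        have := addOrderOf_nsmul_eq_zero ((1 / n : ℚ) : AddCircle (1 : ℚ))
        rw [hord] at this
        simp only [Set.mem_ofPred_eq]
        rw [smul_comm, this, smul_zero]

theorem bijOn_add_fiber (n : ℕ) (y a : AddCircle (1 : ℚ)) :
    Set.BijOn (· + y) {x | n • x = a} {x | n • x = a + n • y} := by
  refine ⟨fun x hx ↦ ?_, (add_left_injective y).injOn, fun x hx ↦ ⟨x - y, ?_, sub_add_cancel x y⟩⟩
  · simp_all [smul_add]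
  · simp_all [smul_sub]

theorem finite_fiber {n : ℕ} (hn : 0 < n) (a : AddCircle (1 : ℚ)) :
    {x : AddCircle (1 : ℚ) | n • x = a}.Finite := by
  obtain ⟨y, rfl⟩ := exists_nsmul_eq hn a
  have h := bijOn_add_fiber n y 0
  rw [zero_add] at h
  exact h.image_eq ▸ (finite_torsion (1 : ℚ) hn).image _

theorem ncard_fiber {n : ℕ} (hn : 0 < n) (a : AddCircle (1 : ℚ)) :
    {x : AddCircle (1 : ℚ) | n • x = a}.ncard = n := by
  obtain ⟨y, rfl⟩ := exists_nsmul_eq hn a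
  have h := bijOn_add_fiber n y 0
  rw [zero_add] at h
  rw [← h.image_eq, Set.ncard_image_of_injective _ (add_left_injective y), ncard_torsion hn]

end AddCircle

theorem eq_zero_of_coprime_nsmul {A : Type*} [AddCommGroup A] {m n : ℕ} (h : m.Coprime n) {x : A}
    (hm : m • x = 0) (hn : n • x = 0) : x = 0 := by
  rw [← addOrderOf_dvd_iff_nsmul_eq_zero] at hm hn
  exact AddMonoid.addOrderOf_eq_one_iff.1 (Nat.eq_one_of_dvd_coprimes h hm hn)

theorem exists_eq_primeToP_add_pPrimary {p : ℕ} (hp : p.Prime) (x : AddCircle (1 : ℚ)) :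
    ∃ (a : primeToP p) (b : pPrimary p), x = a + b := by
  obtain ⟨n, hn, hx⟩ := AddCircle.exists_pos_nsmul_eq_zero x
  obtain ⟨k, m, hm, rfl⟩ := Nat.exists_eq_pow_mul_and_not_dvd hn.ne' p hp.ne_one
  have hmp : m.Coprime p := ((Nat.Prime.coprime_iff_not_dvd hp).2 hm).symm
  obtain ⟨u, v, huv⟩ := Nat.isCoprime_iff_coprime.2 (hmp.pow_right k)
  have hx' : ((p : ℤ) ^ k * m) • x = 0 := by
    rw [← hx, ← natCast_zsmul]; push_cast; rfl
  refine ⟨⟨(v * (p : ℤ) ^ k) • x, m, hmp, ?_⟩, ⟨(u * m : ℤ) • x, k, ?_⟩, ?_⟩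
  · rw [← natCast_zsmul, smul_smul, show (m : ℤ) * (v * (p : ℤ) ^ k) = v * ((p : ℤ) ^ k * m) by ring,
      mul_smul, hx', smul_zero]
  · rw [← natCast_zsmul, smul_smul, Nat.cast_pow,
      show (p : ℤ) ^ k * (u * m) = u * ((p : ℤ) ^ k * m) by ring, mul_smul, hx', smul_zero]
  · push_cast at huv
    rw [← add_smul, add_comm, huv, one_smul]

theorem eq_zero_of_mem_primeToP_of_mem_pPrimary {p : ℕ} {x : AddCircle (1 : ℚ)}
    (h₁ : x ∈ primeToP p) (h₂ : x ∈ pPrimary p) : x = 0 := by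
  obtain ⟨m, hm, hx⟩ := h₁
  obtain ⟨k, hk⟩ := h₂
  exact eq_zero_of_coprime_nsmul (hm.pow_right k) hx hk

theorem exists_nsmul_eq_pPrimary {p : ℕ} (hp : p.Prime) {n : ℕ} (hn : 0 < n) (b : pPrimary p) :
    ∃ c : pPrimary p, n • c = b := by
  obtain ⟨y, hy⟩ := AddCircle.exists_nsmul_eq hn (b : AddCircle (1 : ℚ))
  obtain ⟨a, c, rfl⟩ := exists_eq_primeToP_add_pPrimary hp y
  rw [smul_add] at hy
  have h : n • (a : AddCircle (1 : ℚ)) = 0 := by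
    refine eq_zero_of_mem_primeToP_of_mem_pPrimary (nsmul_mem a.2 n) ?_
    rw [eq_sub_of_add_eq hy]
    exact sub_mem b.2 (nsmul_mem c.2 n)
  exact ⟨c, Subtype.ext (by simpa [h] using hy)⟩

theorem bijective_pow_smul_primeToP (p k : ℕ) :
    Function.Bijective (nsmulAddMonoidHom (α := primeToP p) (p ^ k)) := by
  constructor
  · rw [injective_iff_map_eq_zero]
    rintro ⟨a, m, hm, ha⟩ h
    refine Subtype.ext (eq_zero_of_coprime_nsmul (hm.pow_right k) ha ?_)
    simpa using congrArg Subtype.val h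
  · rintro ⟨a, m, hm, ha⟩
    obtain ⟨u, v, huv⟩ := Nat.isCoprime_iff_coprime.2 (hm.pow_right k)
    refine ⟨v • ⟨a, m, hm, ha⟩, Subtype.ext ?_⟩
    have hm' : (m : ℤ) • a = 0 := by simpa using ha
    calc (p ^ k) • v • a = (u * m + v * (p ^ k : ℕ) : ℤ) • a := by
          rw [add_smul, mul_smul, hm', smul_zero, zero_add, mul_comm, mul_smul, natCast_zsmul]
      _ = a := by rw [huv, one_smul]

/-- `r ∘ ρ̃_n = r ∘ ρ̃_n ∘ j ∘ r`, and `σ_{p^k}` restricts to an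
automorphism of `ℤ[μ^(p)]` with `σ_{p^k} ∘ r ∘ ρ̃_{p^k} = p^k · r`. -/
theorem stmt2 (p : ℕ) (hp : p.Prime)
    (σ : ℕ → (AddMonoidAlgebra ℤ (AddCircle (1 : ℚ)) →+* AddMonoidAlgebra ℤ (AddCircle (1 : ℚ))))
    (ρ : ℕ → (AddMonoidAlgebra ℤ (AddCircle (1 : ℚ)) →+ AddMonoidAlgebra ℤ (AddCircle (1 : ℚ))))
    (hσ : ∀ n : ℕ, 0 < n → ∀ γ : AddCircle (1 : ℚ),
      σ n (AddMonoidAlgebra.single γ 1) = AddMonoidAlgebra.single (n • γ) 1)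
    (hρ : ∀ n : ℕ, 0 < n → ∀ γ : AddCircle (1 : ℚ),
      ρ n (AddMonoidAlgebra.single γ 1)
        = ∑ᶠ γ' ∈ {γ' : AddCircle (1 : ℚ) | n • γ' = γ}, AddMonoidAlgebra.single γ' (1 : ℤ))
    (r : AddMonoidAlgebra ℤ (AddCircle (1 : ℚ)) →+* AddMonoidAlgebra ℤ ↥(primeToP p))
    (hr : ∀ (a : ↥(primeToP p)) (b : ↥(pPrimary p)),
      r (AddMonoidAlgebra.single ((a : AddCircle (1 : ℚ)) + (b : AddCircle (1 : ℚ))) 1)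
        = AddMonoidAlgebra.single a 1)
    (j : AddMonoidAlgebra ℤ ↥(primeToP p) →+* AddMonoidAlgebra ℤ (AddCircle (1 : ℚ)))
    (hj : ∀ a : ↥(primeToP p),
      j (AddMonoidAlgebra.single a 1) = AddMonoidAlgebra.single (a : AddCircle (1 : ℚ)) 1) :
    (∀ (n : ℕ), 0 < n → ∀ x, r (ρ n x) = r (ρ n (j (r x)))) ∧
    (∀ k : ℕ, ∃ τ : AddMonoidAlgebra ℤ ↥(primeToP p) ≃+* AddMonoidAlgebra ℤ ↥(primeToP p),
      (∀ a : ↥(primeToP p),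
        τ (AddMonoidAlgebra.single a 1) = AddMonoidAlgebra.single ((p ^ k) • a) 1) ∧
      (∀ x, j (τ x) = σ (p ^ k) (j x)) ∧
      (∀ x, τ (r (ρ (p ^ k) x)) = (p ^ k : ℤ) • r x)) := by
  have hr' (a : primeToP p) : r (.single (a : AddCircle (1 : ℚ)) 1) = .single a 1 := by
    simpa using hr a 0
  have hrρ {B : Type} [AddCommGroup B] (f : AddMonoidAlgebra ℤ (primeToP p) →+ B) (n : ℕ)
      (hn : 0 < n) (γ : AddCircle (1 : ℚ)) : f (r (ρ n (.single γ 1))) =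
        ∑ᶠ γ' ∈ {γ' : AddCircle (1 : ℚ) | n • γ' = γ}, f (r (.single γ' 1)) := by
    rw [hρ n hn]
    exact (f.comp r.toAddMonoidHom).map_finsum_mem _ (AddCircle.finite_fiber hn γ)
  refine ⟨fun n hn x ↦ ?_, fun k ↦ ?_⟩
  · suffices h : r.toAddMonoidHom.comp (ρ n) =
        (r.toAddMonoidHom.comp (ρ n)).comp (j.toAddMonoidHom.comp r.toAddMonoidHom) from
      DFunLike.congr_fun h x
    refine AddMonoidAlgebra.addHom_ext_int fun γ ↦ ?_
    obtain ⟨a, b, rfl⟩ := exists_eq_primeToP_add_pPrimary hp γ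
    obtain ⟨c, rfl⟩ := exists_nsmul_eq_pPrimary hp hn b
    change r (ρ n _) = r (ρ n (j (r _)))
    rw [hr, hj]
    refine (hrρ (.id _) n hn _).trans (.trans ?_ (hrρ (.id _) n hn _).symm)
    refine (finsum_mem_eq_of_bijOn _ (AddCircle.bijOn_add_fiber n c a) fun γ _ ↦ ?_).symm
    obtain ⟨a', b', rfl⟩ := exists_eq_primeToP_add_pPrimary hp γ
    have h := hr a' (b' + c)
    rw [AddSubgroup.coe_add, ← add_assoc] at h
    simp only [AddMonoidHom.id_apply, hr, h]
  · have hpk : 0 < p ^ k := pow_pos hp.pos k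
    let e := AddEquiv.ofBijective _ (bijective_pow_smul_primeToP p k)
    let τ := AddMonoidAlgebra.mapDomainRingEquiv ℤ e
    have hτ (a : primeToP p) : τ (.single a 1) = .single ((p ^ k) • a) 1 :=
      AddMonoidAlgebra.mapDomainRingEquiv_single ..
    refine ⟨τ, hτ, fun x ↦ ?_, fun x ↦ ?_⟩
    · suffices h : j.toAddMonoidHom.comp τ.toAddMonoidHom =
          (σ (p ^ k)).toAddMonoidHom.comp j.toAddMonoidHom from DFunLike.congr_fun h x
      refine AddMonoidAlgebra.addHom_ext_int fun a ↦ ?_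
      change j (τ _) = σ (p ^ k) (j _)
      rw [hτ, hj, hj, hσ _ hpk, AddSubgroup.coe_nsmul]
    · suffices h : τ.toAddMonoidHom.comp (r.toAddMonoidHom.comp (ρ (p ^ k))) =
          (p ^ k : ℤ) • r.toAddMonoidHom from DFunLike.congr_fun h x
      refine AddMonoidAlgebra.addHom_ext_int fun γ ↦ ?_
      refine (hrρ τ.toAddMonoidHom (p ^ k) hpk γ).trans ?_
      have hτr (γ' : AddCircle (1 : ℚ)) (h : γ' ∈ {γ' | p ^ k • γ' = γ}) :
          τ.toAddMonoidHom (r (.single γ' 1)) = r (.single γ 1) := by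
        obtain ⟨a, b, rfl⟩ := exists_eq_primeToP_add_pPrimary hp γ'
        obtain rfl : _ = γ := h
        have h := hr (p ^ k • a) (p ^ k • b)
        rw [AddSubgroup.coe_nsmul, AddSubgroup.coe_nsmul, ← smul_add] at h
        rw [h, hr]
        exact hτ a
      have hfin := AddCircle.finite_fiber hpk γ
      rw [finsum_mem_congr rfl hτr, finsum_mem_eq_finite_toFinset_sum _ hfin, Finset.sum_const,
        ← Set.ncard_eq_toFinset_card _ hfin, AddCircle.ncard_fiber hpk γ, ← natCast_zsmul]
      simp
end

section
/- Let n ≥ 2 and b ≥ 1 be integers and let z ∈ ℂ satisfy z^b = 1. If z ≠ 1 then b^{n−1} · ∑_{j=0}^{b−1} z^j · B_n(j/b) = −n · ℓ_{1−n}(z), while if z = 1 then b^{n−1} · ∑_{j=0}^{b−1} B_n(j/b) = B_n, the n-th Bernoulli number. -/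
open scoped BigOperators

/-- The rational functions `ℓ_{−k}`, defined inductively by `ℓ_0(z) = z/(1−z)` and
`ℓ_{−(k+1)}(z) = z · (d/dz) ℓ_{−k}(z)`. -/
noncomputable def ell : ℕ → ℂ → ℂ
  | 0 => fun z => z / (1 - z)
  | (k + 1) => fun z => z * deriv (ell k) z

open PowerSeries in
/-- The generating function of the sums `b ^ n * ∑ z ^ j * B_n(j / b)` is `b * X / (z * e ^ X - 1)`
when `z ^ b = 1`. -/
theorem bernoulli_twisted_sum_generating_function {b : ℕ} (hb : b ≠ 0) {z : ℂ} (hz : z ^ b = 1) :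
    (PowerSeries.mk fun n => (b : ℂ) ^ n * (∑ j ∈ Finset.range b,
      z ^ j * Polynomial.aeval ((j : ℂ) / (b : ℂ)) (Polynomial.bernoulli n)) / n.factorial) *
        (C z * exp ℂ - 1) = C (b : ℂ) * X := by
  have hb' : (b : ℂ) ≠ 0 := by exact_mod_cast hb
  have hE : exp ℂ ^ b - 1 ≠ 0 := by
    intro h
    have h1 := congrArg (coeff 1) h
    rw [exp_pow_eq_rescale_exp] at h1
    simp [coeff_rescale, coeff_exp, coeff_one, hb] at h1
  have hterm (j : ℕ) : rescale (b : ℂ) (PowerSeries.mk fun n =>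
      Polynomial.aeval ((j : ℂ) / b) ((1 / n.factorial : ℚ) • Polynomial.bernoulli n)) *
        (exp ℂ ^ b - 1) = C (b : ℂ) * X * exp ℂ ^ j := by
    have h := congrArg (rescale (b : ℂ))
      (Polynomial.bernoulli_generating_function ((j : ℂ) / b))
    rw [map_mul, map_mul, map_sub, map_one, rescale_X, ← exp_pow_eq_rescale_exp,
      rescale_rescale, div_mul_cancel₀ _ hb', ← exp_pow_eq_rescale_exp] at h
    exact h
  have hsum : (PowerSeries.mk fun n => (b : ℂ) ^ n * (∑ j ∈ Finset.range b,
      z ^ j * Polynomial.aeval ((j : ℂ) / (b : ℂ)) (Polynomial.bernoulli n)) / n.factorial) =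
      ∑ j ∈ Finset.range b, C z ^ j * rescale (b : ℂ) (PowerSeries.mk fun n =>
        Polynomial.aeval ((j : ℂ) / b) ((1 / n.factorial : ℚ) • Polynomial.bernoulli n)) := by
    ext n
    rw [map_sum, coeff_mk, Finset.mul_sum, Finset.sum_div]
    refine Finset.sum_congr rfl fun j _ => ?_
    rw [← map_pow, coeff_C_mul, coeff_rescale, coeff_mk, map_smul, Rat.smul_def]
    push_cast
    ring
  apply mul_right_cancel₀ hE
  rw [hsum, mul_right_comm, Finset.sum_mul]
  simp_rw [mul_assoc (C z ^ _), hterm]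
  have hgeom := geom_sum_mul (C z * exp ℂ) b
  rw [mul_pow, ← map_pow, hz, map_one, one_mul] at hgeom
  rw [← hgeom, ← mul_assoc, Finset.mul_sum]
  congr 1
  refine Finset.sum_congr rfl fun j _ => ?_
  rw [mul_pow]
  ring

theorem differentiableOn_ell (k : ℕ) : DifferentiableOn ℂ (ell k) {1}ᶜ := by
  induction k with
  | zero =>
    intro z hz
    have : 1 - z ≠ 0 := sub_ne_zero.mpr (Ne.symm hz)
    exact (DifferentiableAt.div (by fun_prop) (by fun_prop) this).differentiableWithinAt
  | succ k ih => exact differentiableOn_id.mul (ih.deriv isOpen_compl_singleton)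

theorem ell_eq_mul_one_add_sum (n : ℕ) {z : ℂ} (hz : z ≠ 1) :
    ell n z = z * (1 + ∑ k ∈ Finset.range (n + 1), (n.choose k : ℂ) * ell k z) := by
  induction n generalizing z with
  | zero =>
    have : 1 - z ≠ 0 := sub_ne_zero.mpr (Ne.symm hz)
    simp only [ell, zero_add, Finset.sum_range_one, Nat.choose_self, Nat.cast_one]
    field_simp
    ring
  | succ n ih =>
    have hd (k : ℕ) : HasDerivAt (ell k) (deriv (ell k) z) z :=
      ((differentiableOn_ell k).differentiableAt
        (isOpen_compl_singleton.mem_nhds hz)).hasDerivAt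
    have hderiv := (hasDerivAt_id z).mul ((HasDerivAt.fun_sum fun k (_ : k ∈ Finset.range (n + 1)) =>
      (hd k).const_mul (n.choose k : ℂ)).const_add 1)
    have heq : ell n =ᶠ[nhds z] fun w =>
        w * (1 + ∑ k ∈ Finset.range (n + 1), (n.choose k : ℂ) * ell k w) :=
      Filter.mem_of_superset (isOpen_compl_singleton.mem_nhds hz) fun w hw => ih hw
    have hpascal := Finset.sum_choose_succ_mul (fun i _ => ell i z) n
    have hstep : deriv (ell n) z = _ := (hderiv.congr_of_eventuallyEq heq).deriv
    rw [hpascal]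
    simp only [ell, hstep, id, mul_add, Finset.mul_sum, one_mul]
    have hcomm : ∀ k, z * ((n.choose k : ℂ) * (z * deriv (ell k) z)) =
        z * (z * ((n.choose k : ℂ) * deriv (ell k) z)) := fun k => by ring
    simp only [hcomm]
    ring

open PowerSeries in
/-- The exponential generating function of `ℓ_{-k}(z)`, increased by one, is
`1 / (1 - z * e ^ X)`. -/
theorem one_add_ell_generating_function {z : ℂ} (hz : z ≠ 1) :
    (1 + PowerSeries.mk fun k => ell k z / k.factorial) * (C z * exp ℂ - 1) = -1 := by
  have h : (PowerSeries.mk fun k => ell k z / (k.factorial : ℂ)) =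
      C z * (exp ℂ + (PowerSeries.mk fun k => ell k z / (k.factorial : ℂ)) * exp ℂ) := by
    ext n
    rw [coeff_C_mul, map_add, coeff_mul, coeff_mk, coeff_exp, ell_eq_mul_one_add_sum n hz,
      Finset.Nat.sum_antidiagonal_eq_sum_range_succ_mk, mul_div_assoc, add_div, Finset.sum_div]
    congr 2
    · simp
    · refine Finset.sum_congr rfl fun k hk => ?_
      have hn : (n.factorial : ℂ) ≠ 0 := by exact_mod_cast n.factorial_ne_zero
      rw [Nat.cast_choose ℂ (Nat.lt_succ_iff.mp (Finset.mem_range.mp hk))]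
      simp only [coeff_mk, coeff_exp, map_div₀, map_one, map_natCast]
      field_simp
  linear_combination -h

/-- for `n ≥ 2`, `b ≥ 1` and `z` a `b`-th root of unity,
`b^{n−1} ∑_{j<b} z^j B_n(j/b) = −n ℓ_{1−n}(z)` if `z ≠ 1`, and the corresponding sum
equals the Bernoulli number `B_n` if `z = 1`. -/
theorem stmt4 (n b : ℕ) (hn : 2 ≤ n) (hb : 1 ≤ b) (z : ℂ) (hz : z ^ b = 1) :
    (z ≠ 1 →
      (b : ℂ) ^ (n - 1) * ∑ j ∈ Finset.range b,
          z ^ j * Polynomial.aeval ((j : ℂ) / (b : ℂ)) (Polynomial.bernoulli n)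
        = -(n : ℂ) * ell (n - 1) z) ∧
    (z = 1 →
      (b : ℂ) ^ (n - 1) * ∑ j ∈ Finset.range b,
          Polynomial.aeval ((j : ℂ) / (b : ℂ)) (Polynomial.bernoulli n)
        = ((bernoulli n : ℚ) : ℂ)) := by
  have hb' : (b : ℂ) ≠ 0 := by exact_mod_cast (by lia : b ≠ 0)
  have hF := bernoulli_twisted_sum_generating_function (by lia : b ≠ 0) hz
  obtain ⟨m, rfl⟩ : ∃ m, n = m + 1 := ⟨n - 1, by lia⟩
  have hfact : ((m + 1).factorial : ℂ) ≠ 0 := by exact_mod_cast (m + 1).factorial_ne_zero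
  rw [Nat.add_sub_cancel]
  constructor
  · intro hz1
    have hL := one_add_ell_generating_function hz1
    have hmul := congrArg
      ((1 + PowerSeries.mk fun k => ell k z / (k.factorial : ℂ)) * ·) hF
    simp only [mul_left_comm _ (PowerSeries.mk _), hL, mul_neg, mul_one] at hmul
    rw [mul_left_comm, neg_eq_iff_eq_neg] at hmul
    have hcoeff := congrArg (PowerSeries.coeff (m + 1)) hmul
    rw [PowerSeries.coeff_mk, map_neg, PowerSeries.coeff_C_mul, PowerSeries.coeff_succ_mul_X,
      map_add, PowerSeries.coeff_one, if_neg (by lia), zero_add, PowerSeries.coeff_mk,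
      div_eq_iff hfact, Nat.factorial_succ, pow_succ] at hcoeff
    have hm : (m.factorial : ℂ) ≠ 0 := by exact_mod_cast m.factorial_ne_zero
    apply mul_left_cancel₀ hb'
    push_cast at hcoeff ⊢
    field_simp at hcoeff
    linear_combination (b : ℂ) * hcoeff
  · rintro rfl
    have hE : PowerSeries.exp ℂ - 1 ≠ 0 := by
      intro h
      have h1 := congrArg (PowerSeries.coeff 1) h
      simp [PowerSeries.coeff_exp, PowerSeries.coeff_one] at h1
    have hB := bernoulliPowerSeries_mul_exp_sub_one ℂ
    rw [map_one, one_mul, ← hB, ← mul_assoc] at hF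
    have hcoeff := congrArg (PowerSeries.coeff (m + 1)) (mul_right_cancel₀ hE hF)
    rw [PowerSeries.coeff_mk, PowerSeries.coeff_C_mul, bernoulliPowerSeries,
      PowerSeries.coeff_mk] at hcoeff
    simp only [one_pow, one_mul, map_div₀, map_natCast, eq_ratCast] at hcoeff
    apply mul_left_cancel₀ hb'
    field_simp at hcoeff
    linear_combination hcoeff
end

section
/- Let n ≥ 2 be an integer, a an integer, and b ≥ 1 an integer. Then the complex number f^{n−1} · ∑_{j=0}^{f−1} e^{2πi·a·j/b} · B_n(j/f) takes the same value for every positive multiple f of b. (Hence this common value, denoted Y_n(a/b), depends only on n and on the class of a/b in ℚ/ℤ.) -/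
open scoped BigOperators Real

lemma Finset.sum_range_mul_eq_sum_sum_add_mul {M : Type*} [AddCommMonoid M] (b m : ℕ)
    (g : ℕ → M) :
    ∑ j ∈ Finset.range (b * m), g j =
      ∑ r ∈ Finset.range b, ∑ i ∈ Finset.range m, g (r + b * i) := by
  induction m with
  | zero => simp
  | succ m ih =>
    simp only [Nat.mul_succ, Finset.sum_range_add, ih, Finset.sum_range_succ,
      Finset.sum_add_distrib, add_comm _ (b * m)]

lemma aeval_ofReal_bernoulli (n : ℕ) (x : ℝ) :
    Polynomial.aeval (x : ℂ) (Polynomial.bernoulli n) = (bernoulliFun n x : ℂ) := by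
  rw [bernoulliFun, Polynomial.eval_map_algebraMap]
  exact Polynomial.aeval_algebraMap_apply ℂ x _

/-- The multiplication theorem for Bernoulli polynomials at rational points, with the powers of
the denominator cleared. -/
lemma pow_mul_sum_aeval_bernoulli {n : ℕ} (hn : 1 ≤ n) {m : ℕ} (hm : m ≠ 0) {b : ℕ}
    (hb : b ≠ 0) (r : ℕ) :
    (m : ℂ) ^ (n - 1) * ∑ i ∈ Finset.range m,
        Polynomial.aeval (((r + b * i : ℕ) : ℂ) / ((b * m : ℕ) : ℂ)) (Polynomial.bernoulli n) =
      Polynomial.aeval ((r : ℂ) / (b : ℂ)) (Polynomial.bernoulli n) := by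
  have hm' : (m : ℝ) ≠ 0 := Nat.cast_ne_zero.mpr hm
  have hb' : (b : ℝ) ≠ 0 := Nat.cast_ne_zero.mpr hb
  have key : (m : ℝ) ^ (n - 1) * ∑ i ∈ Finset.range m,
      bernoulliFun n (((r + b * i : ℕ) : ℝ) / ((b * m : ℕ) : ℝ)) = bernoulliFun n (r / b) := by
    have h := bernoulliFun_mul n hm (r / (b * m))
    rw [show (m : ℝ) * (r / (b * m)) = r / b by field_simp] at h
    rw [h, pow_sub₀ _ hm' hn, pow_one, div_eq_mul_inv]
    congr 1
    refine Finset.sum_congr rfl fun i _ => ?_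
    congr 1
    push_cast
    field_simp
  have h := congrArg (fun x : ℝ => (x : ℂ)) key
  simpa [← aeval_ofReal_bernoulli] using h

lemma pow_mul_sum_periodic_mul_aeval_bernoulli {n : ℕ} (hn : 1 ≤ n) {m : ℕ} (hm : m ≠ 0)
    {b : ℕ} (hb : b ≠ 0) {c : ℕ → ℂ} (hc : Function.Periodic c b) :
    ((b * m : ℕ) : ℂ) ^ (n - 1) * ∑ j ∈ Finset.range (b * m),
        c j * Polynomial.aeval ((j : ℂ) / ((b * m : ℕ) : ℂ)) (Polynomial.bernoulli n) =
      (b : ℂ) ^ (n - 1) * ∑ j ∈ Finset.range b,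
        c j * Polynomial.aeval ((j : ℂ) / (b : ℂ)) (Polynomial.bernoulli n) := by
  rw [Finset.sum_range_mul_eq_sum_sum_add_mul, Nat.cast_mul, mul_pow, mul_assoc, ← Nat.cast_mul,
    Finset.mul_sum]
  congr 1
  refine Finset.sum_congr rfl fun r _ => ?_
  have hper (i : ℕ) : c (r + b * i) = c r := by
    rw [mul_comm]; exact hc.nat_mul i r
  simp_rw [hper, ← Finset.mul_sum]
  rw [mul_left_comm, pow_mul_sum_aeval_bernoulli hn hm hb]

lemma periodic_exp_two_pi_mul_div (a : ℤ) {b : ℕ} (hb : b ≠ 0) :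
    Function.Periodic (fun j : ℕ =>
      Complex.exp (2 * (π : ℂ) * Complex.I * (a : ℂ) * (j : ℂ) / (b : ℂ))) b := by
  intro j
  have hb' : (b : ℂ) ≠ 0 := Nat.cast_ne_zero.mpr hb
  refine Complex.exp_eq_exp_iff_exists_int.mpr ⟨a, ?_⟩
  push_cast
  field_simp

/-- for `n ≥ 2`, the quantity
`f^{n−1} ∑_{j<f} e^{2πi·a·j/b} B_n(j/f)` is the same for every positive multiple `f` of `b`. -/
theorem stmt5 (n : ℕ) (hn : 2 ≤ n) (a : ℤ) (b : ℕ) (hb : 1 ≤ b)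
    (f₁ f₂ : ℕ) (hf₁ : 0 < f₁) (hf₂ : 0 < f₂) (h₁ : b ∣ f₁) (h₂ : b ∣ f₂) :
    (f₁ : ℂ) ^ (n - 1) * ∑ j ∈ Finset.range f₁,
        Complex.exp (2 * (π : ℂ) * Complex.I * (a : ℂ) * (j : ℂ) / (b : ℂ)) *
          Polynomial.aeval ((j : ℂ) / (f₁ : ℂ)) (Polynomial.bernoulli n)
      = (f₂ : ℂ) ^ (n - 1) * ∑ j ∈ Finset.range f₂,
        Complex.exp (2 * (π : ℂ) * Complex.I * (a : ℂ) * (j : ℂ) / (b : ℂ)) *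
          Polynomial.aeval ((j : ℂ) / (f₂ : ℂ)) (Polynomial.bernoulli n) := by
  have hb' : b ≠ 0 := by lia
  obtain ⟨m₁, rfl⟩ := h₁
  obtain ⟨m₂, rfl⟩ := h₂
  have hper := periodic_exp_two_pi_mul_div a hb'
  have hn' : 1 ≤ n := by lia
  exact (pow_mul_sum_periodic_mul_aeval_bernoulli hn' (Nat.pos_of_mul_pos_left hf₁).ne' hb'
    hper).trans (pow_mul_sum_periodic_mul_aeval_bernoulli hn'
      (Nat.pos_of_mul_pos_left hf₂).ne' hb' hper).symm
end

section
/- Let n ≥ 2 and b ≥ 1 be integers. Then ∑_{a=0}^{b−1} Y_n(a/b) = b^n · B_n, where B_n is the n-th Bernoulli number; equivalently, (1/b)·∑_{a=0}^{b−1} Y_n(a/b) = b^{n−1} · Y_n(0). -/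
open scoped BigOperators Real

/-- Orthogonality of the additive characters of `ℤ/bℤ`. -/
theorem sum_exp_two_pi_mul_div {b j : ℕ} (hj : j < b) :
    ∑ a ∈ Finset.range b,
        Complex.exp (2 * (π : ℂ) * Complex.I * ((a : ℤ) : ℂ) * (j : ℂ) / (b : ℂ)) =
      if j = 0 then (b : ℂ) else 0 := by
  split_ifs with h
  · simp [h]
  have hb : b ≠ 0 := by omega
  have hζ := Complex.isPrimitiveRoot_exp b hb
  set ζ := Complex.exp (2 * (π : ℂ) * Complex.I / (b : ℂ)) with hζ_def
  have hterm (a : ℕ) :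
      Complex.exp (2 * (π : ℂ) * Complex.I * ((a : ℤ) : ℂ) * (j : ℂ) / (b : ℂ)) =
        (ζ ^ j) ^ a := by
    rw [← pow_mul, hζ_def, ← Complex.exp_nat_mul]
    congr 1
    push_cast
    ring
  simp_rw [hterm]
  have hne : ζ ^ j - 1 ≠ 0 := sub_ne_zero.mpr (hζ.pow_ne_one_of_pos_of_lt h hj)
  refine (mul_eq_zero.mp ?_).resolve_right hne
  rw [geom_sum_mul, ← pow_mul, mul_comm, pow_mul, hζ.pow_eq_one, one_pow, sub_self]

theorem aeval_bernoulli_zero (n : ℕ) :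
    Polynomial.aeval (0 : ℂ) (Polynomial.bernoulli n) = ((bernoulli n : ℚ) : ℂ) := by
  have h := Polynomial.aeval_algebraMap_apply ℂ (0 : ℚ) (Polynomial.bernoulli n)
  rwa [map_zero, Polynomial.coe_aeval_eq_eval, Polynomial.bernoulli_eval_zero] at h

/-- if `Y` is the function with `Y(a/b) = f^{n−1} ∑_{j<f} e^{2πi a j/b} B_n(j/f)`
(for any positive multiple `f` of `b`), then `∑_{a=0}^{b−1} Y(a/b) = b^n·B_n`;
equivalently `(1/b) ∑_{a<b} Y(a/b) = b^{n−1}·Y(0)`. -/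
theorem stmt6 (n : ℕ) (hn : 2 ≤ n) (Y : ℚ → ℂ)
    (hY : ∀ (a : ℤ) (b f : ℕ), 0 < b → 0 < f → b ∣ f →
      Y ((a : ℚ) / (b : ℚ)) = (f : ℂ) ^ (n - 1) * ∑ j ∈ Finset.range f,
        Complex.exp (2 * (π : ℂ) * Complex.I * (a : ℂ) * (j : ℂ) / (b : ℂ)) *
          Polynomial.aeval ((j : ℂ) / (f : ℂ)) (Polynomial.bernoulli n))
    (b : ℕ) (hb : 1 ≤ b) :
    (∑ a ∈ Finset.range b, Y ((a : ℚ) / (b : ℚ)) = (b : ℂ) ^ n * ((bernoulli n : ℚ) : ℂ)) ∧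
    ((1 / (b : ℂ)) * ∑ a ∈ Finset.range b, Y ((a : ℚ) / (b : ℚ))
      = (b : ℂ) ^ (n - 1) * Y 0) := by
  have hb0 : (b : ℂ) ≠ 0 := Nat.cast_ne_zero.mpr (by omega)
  have hpow : (b : ℂ) ^ n = (b : ℂ) ^ (n - 1) * b := by
    rw [← pow_succ, Nat.sub_add_cancel (by omega)]
  have hY0 : Y 0 = ((bernoulli n : ℚ) : ℂ) := by
    have h := hY 0 1 1 one_pos one_pos dvd_rfl
    simpa [aeval_bernoulli_zero] using h
  have hsum : ∑ a ∈ Finset.range b, Y ((a : ℚ) / (b : ℚ)) =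
      (b : ℂ) ^ n * ((bernoulli n : ℚ) : ℂ) := by
    have hterm (a : ℕ) := hY a b b hb hb dvd_rfl
    simp only [Int.cast_natCast (R := ℚ)] at hterm
    simp_rw [hterm]
    rw [← Finset.mul_sum, Finset.sum_comm]
    simp_rw [← Finset.sum_mul]
    rw [Finset.sum_congr rfl fun j hj => by
      rw [sum_exp_two_pi_mul_div (Finset.mem_range.mp hj)]]
    simp only [ite_mul, zero_mul, Finset.sum_ite_eq', Finset.mem_range]
    rw [if_pos (by omega), Nat.cast_zero, zero_div, aeval_bernoulli_zero, hpow, mul_assoc]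
  refine ⟨hsum, ?_⟩
  rw [hsum, hY0, hpow]
  field_simp
end

section
/- Let θ be an automorphism of the additive group ℚ/ℤ with θ ≠ id and θ ≠ −id (negation). Then the set {(ι(α), ι(θ(α))) : α ∈ ℚ/ℤ} is dense in the torus (ℝ/ℤ) × (ℝ/ℤ), where ι : ℚ/ℤ → ℝ/ℤ is the canonical embedding induced by ℚ ⊂ ℝ. -/
/-- The canonical embedding `ℚ/ℤ → ℝ/ℤ` induced by the inclusion `ℚ ⊂ ℝ`. -/
noncomputable def iota : AddCircle (1 : ℚ) →+ AddCircle (1 : ℝ) :=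
  QuotientAddGroup.map (AddSubgroup.zmultiples (1 : ℚ)) (AddSubgroup.zmultiples (1 : ℝ))
    (Rat.castHom ℝ).toAddMonoidHom (by
      intro x hx
      obtain ⟨k, hk⟩ := AddSubgroup.mem_zmultiples_iff.mp hx
      refine AddSubgroup.mem_comap.mpr (AddSubgroup.mem_zmultiples_iff.mpr ⟨k, ?_⟩)
      simp only [RingHom.toAddMonoidHom_eq_coe, AddMonoidHom.coe_coe, Rat.coe_castHom]
      rw [← hk]
      norm_num)

namespace UnitAddTorus

variable {d : Type*} [Fintype d]

open MeasureTheory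

theorem mFourier_add_apply (n : d → ℤ) (x y : UnitAddTorus d) :
    mFourier n (x + y) = mFourier n x * mFourier n y := by
  simp [mFourier, fourier_apply, smul_add, AddCircle.toCircle_add, Finset.prod_mul_distrib]

theorem mFourierCoeff_eq_zero_of_add_right_invariant {f : UnitAddTorus d → ℂ}
    {h : UnitAddTorus d} (hf : ∀ x, f (x + h) = f x) {n : d → ℤ} (hn : mFourier (-n) h ≠ 1) :
    mFourierCoeff f n = 0 := by
  have key : mFourierCoeff f n = mFourier (-n) h * mFourierCoeff f n := by
    change ∫ t, mFourier (-n) t • f t ∂(Measure.pi fun _ => AddCircle.haarAddCircle) =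
      _ * ∫ t, mFourier (-n) t • f t ∂(Measure.pi fun _ => AddCircle.haarAddCircle)
    conv_lhs => rw [← integral_add_right_eq_self _ h]
    rw [← integral_const_mul]
    congr 1 with t
    rw [hf, mFourier_add_apply, smul_eq_mul, smul_eq_mul]
    ring
  have : (mFourier (-n) h - 1) * mFourierCoeff f n = 0 := by linear_combination -key
  exact (mul_eq_zero.mp this).resolve_left (sub_ne_zero.mpr hn)

theorem infDist_add_mem (H : AddSubgroup (UnitAddTorus d)) {h : UnitAddTorus d} (hh : h ∈ H)
    (x : UnitAddTorus d) : Metric.infDist (x + h) H = Metric.infDist x H := by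
  have himage : (· + h) '' (H : Set (UnitAddTorus d)) = H := by
    ext y
    constructor
    · rintro ⟨z, hz, rfl⟩
      exact H.add_mem hz hh
    · exact fun hy => ⟨y - h, H.sub_mem hy hh, sub_add_cancel y h⟩
  have hiso : Isometry fun y : UnitAddTorus d => y + h :=
    Isometry.of_dist_eq fun y z => dist_add_right y z h
  conv_lhs => rw [← himage]
  exact Metric.infDist_image hiso

/-- A subgroup of the torus is dense if no nontrivial character is trivial on it. -/
theorem dense_of_forall_mFourier_eq_one (H : AddSubgroup (UnitAddTorus d))
    (hH : ∀ n : d → ℤ, (∀ h ∈ H, mFourier n h = 1) → n = 0) :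
    Dense (H : Set (UnitAddTorus d)) := by
  let f : C(UnitAddTorus d, ℂ) :=
    ⟨fun x => (Metric.infDist x H : ℂ),
      Complex.continuous_ofReal.comp (Metric.continuous_infDist_pt _)⟩
  have hcoeff : ∀ n ≠ 0, mFourierCoeff f n = 0 := by
    intro n hn
    obtain ⟨h, hh, hne⟩ : ∃ h ∈ H, mFourier (-n) h ≠ 1 := by
      by_contra! hall
      exact hn (neg_eq_zero.mp (hH _ hall))
    exact mFourierCoeff_eq_zero_of_add_right_invariant
      (fun x => congrArg Complex.ofReal (infDist_add_mem H hh x)) hne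
  have hconst (x : UnitAddTorus d) : f x = mFourierCoeff f 0 := by
    have hsum := hasSum_mFourier_series_apply_of_summable
      (summable_of_ne_finset_zero (s := {0}) fun n hn => hcoeff n (by simpa using hn)) x
    refine hsum.unique ?_
    simpa [mFourier_zero] using hasSum_single (f := fun n => mFourierCoeff f n • mFourier n x) 0
      fun n hn => by simp [hcoeff n hn]
  intro x
  rw [Metric.mem_closure_iff_infDist_zero ⟨0, H.zero_mem⟩]
  have hx : f x = f 0 := (hconst x).trans (hconst 0).symm
  exact (Complex.ofReal_injective hx).trans (Metric.infDist_zero_of_mem H.zero_mem)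

end UnitAddTorus

theorem iota_injective : Function.Injective iota := by
  rw [injective_iff_map_eq_zero]
  intro a
  induction a using QuotientAddGroup.induction_on with
  | H q =>
    intro hq
    obtain ⟨k, hk⟩ := (AddCircle.coe_eq_zero_iff (1 : ℝ)).mp
      (show (((q : ℚ) : ℝ) : AddCircle (1 : ℝ)) = 0 from hq)
    refine (AddCircle.coe_eq_zero_iff (1 : ℚ)).mpr ⟨k, ?_⟩
    have : ((k : ℚ) : ℝ) = (q : ℝ) := by simpa using hk
    simpa using Rat.cast_injective this

namespace AddCircle

theorem exists_zsmul_eq {n : ℤ} (hn : n ≠ 0) (x : AddCircle (1 : ℚ)) : ∃ y, n • y = x :=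
  ⟨DivisibleBy.div x n, DivisibleBy.div_cancel x hn⟩

theorem exists_zsmul_eq_zero_and_dvd {n : ℤ} (hn : n ≠ 0) :
    ∃ x : AddCircle (1 : ℚ), n • x = 0 ∧ ∀ m : ℤ, m • x = 0 → n ∣ m := by
  have hn' : (n : ℚ) ≠ 0 := Int.cast_ne_zero.mpr hn
  refine ⟨((1 / n : ℚ) : AddCircle (1 : ℚ)), ?_, fun m hm => ?_⟩
  · rw [← coe_zsmul, coe_eq_zero_iff]
    exact ⟨1, by simp [hn']⟩
  · rw [← coe_zsmul, coe_eq_zero_iff] at hm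
    obtain ⟨k, hk⟩ := hm
    refine ⟨k, ?_⟩
    simp only [zsmul_eq_mul, mul_one] at hk
    field_simp at hk
    rw [mul_comm] at hk
    exact_mod_cast hk.symm

/-- An automorphism of `ℚ/ℤ` other than `±id` satisfies no nontrivial integral relation. -/
theorem eq_zero_of_zsmul_add_zsmul_eq_zero (θ : AddCircle (1 : ℚ) ≃+ AddCircle (1 : ℚ))
    (h1 : ∃ x, θ x ≠ x) (h2 : ∃ x, θ x ≠ -x) {m n : ℤ}
    (h : ∀ x, m • x + n • θ x = 0) : m = 0 ∧ n = 0 := by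
  obtain ⟨a, ha⟩ := h1
  obtain ⟨b, hb⟩ := h2
  have hm : m ≠ 0 → m ∣ n := fun hm => by
    obtain ⟨x, hx, hdvd⟩ := exists_zsmul_eq_zero_and_dvd hm
    refine hdvd n (θ.injective ?_)
    simpa [hx] using h x
  have hn : n ≠ 0 → n ∣ m := fun hn => by
    obtain ⟨x, hx, hdvd⟩ := exists_zsmul_eq_zero_and_dvd hn
    refine hdvd m (θ.symm.injective ?_)
    simpa [hx] using h (θ.symm x)
  have hn0 : n = 0 := by
    by_contra hne
    have hm0 : m ≠ 0 := by
      rintro rfl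
      obtain ⟨y, hy⟩ := exists_zsmul_eq hne a
      have : θ a = 0 := by rw [← hy]; simpa using h y
      have ha0 : a = 0 := by simpa using this
      exact ha (by rw [this, ha0])
    rcases Int.natAbs_eq_natAbs_iff.mp (Int.natAbs_eq_of_dvd_dvd (hm hm0) (hn hne)) with e | e
    · obtain ⟨y, hy⟩ := exists_zsmul_eq hne b
      have := h y
      rw [e, ← map_zsmul, hy] at this
      exact hb (eq_neg_of_add_eq_zero_right this)
    · obtain ⟨y, hy⟩ := exists_zsmul_eq hne a
      have := h y
      rw [e, ← map_zsmul, neg_smul, hy] at this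
      exact ha (neg_add_eq_zero.mp this).symm
  subst hn0
  refine ⟨?_, rfl⟩
  by_contra hne
  obtain ⟨y, hy⟩ := exists_zsmul_eq hne a
  have ha0 : a = 0 := by rw [← hy]; simpa using h y
  exact ha (by rw [ha0, map_zero])

end AddCircle

/-- for an automorphism `θ` of `ℚ/ℤ` with `θ ≠ ±id`, the graph of `θ`
is dense in the torus `(ℝ/ℤ) × (ℝ/ℤ)`. -/
theorem stmt9 (θ : AddCircle (1 : ℚ) ≃+ AddCircle (1 : ℚ))
    (h1 : ∃ x, θ x ≠ x) (h2 : ∃ x, θ x ≠ -x) :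
    Dense (Set.range fun α : AddCircle (1 : ℚ) => (iota α, iota (θ α))) := by
  let g : AddCircle (1 : ℚ) →+ UnitAddTorus (Fin 2) :=
    { toFun := fun α => ![iota α, iota (θ α)]
      map_zero' := by simp
      map_add' := fun x y => by simp }
  have hdense : Dense (g.range : Set (UnitAddTorus (Fin 2))) := by
    refine UnitAddTorus.dense_of_forall_mFourier_eq_one _ fun n hn => ?_
    have hrel (x : AddCircle (1 : ℚ)) : n 0 • x + n 1 • θ x = 0 := by
      have hx : UnitAddTorus.mFourier n (g x) = 1 := hn _ ⟨x, rfl⟩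
      apply iota_injective
      apply AddCircle.injective_toCircle one_ne_zero
      apply Circle.coe_injective
      simpa [UnitAddTorus.mFourier, g, Fin.prod_univ_two, fourier_apply,
        AddCircle.toCircle_add] using hx
    obtain ⟨h0, h1⟩ := AddCircle.eq_zero_of_zsmul_add_zsmul_eq_zero θ h1 h2 hrel
    ext i
    fin_cases i
    exacts [h0, h1]
  have himage := (Homeomorph.finTwoArrow (X := AddCircle (1 : ℝ))).surjective.denseRange.dense_image
    Homeomorph.finTwoArrow.continuous hdense
  refine himage.mono ?_
  rintro _ ⟨_, ⟨α, rfl⟩, rfl⟩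
  exact ⟨α, rfl⟩
end

section
/- Let ρ₀ : ℚ[ℚ/ℤ] → ℂ be the ring homomorphism from the rational group algebra of ℚ/ℤ determined by ρ₀(e(γ)) = e^{2πiγ} for γ ∈ ℚ/ℤ. Then the kernel of ρ₀ is exactly the ideal J of ℚ[ℚ/ℤ] generated by the idempotents π_n = (1/n)·∑_{j=0}^{n−1} e(j/n) for n ≥ 2. Consequently ρ₀ induces a ring isomorphism of ℚ[ℚ/ℤ]/J with the subfield of ℂ generated by all roots of unity. -/
open scoped BigOperators Real

open Polynomial in
/-- In a `ℚ`-algebra, if `t ^ n = 1` and, for each prime `p ∣ n`, the sum of the powers of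
`t ^ (n / p)` vanishes, then `t` is a root of the `n`-th cyclotomic polynomial. -/
theorem aeval_cyclotomic_eq_zero_of_sum_pow {B : Type*} [CommRing B] [Algebra ℚ B] {n : ℕ}
    (hn : 0 < n) {t : B} (ht : t ^ n = 1)
    (hsum : ∀ p m : ℕ, p.Prime → n = m * p → ∑ j ∈ Finset.range p, (t ^ m) ^ j = 0) :
    aeval t (cyclotomic n ℚ) = 0 := by
  have hprod : aeval t (∏ d ∈ n.properDivisors, cyclotomic d ℚ) * aeval t (cyclotomic n ℚ) = 0 := by
    rw [← map_mul, mul_comm,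
      ← Finset.prod_insert (f := fun d => cyclotomic d ℚ) Nat.self_notMem_properDivisors,
      Nat.insert_self_properDivisors hn.ne', prod_cyclotomic_eq_X_pow_sub_one hn]
    simp [ht]
  have hunit : IsUnit (aeval t (∏ d ∈ n.properDivisors, cyclotomic d ℚ)) := by
    rw [map_prod, IsUnit.prod_iff]
    intro d hd
    obtain ⟨⟨k, rfl⟩, hlt⟩ := Nat.mem_properDivisors.1 hd
    obtain ⟨p, hp, l, rfl⟩ := Nat.exists_prime_and_dvd (n := k) (by rintro rfl; simp at hlt)
    have h0 := hsum p (d * l) hp (by ring)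
    have hdvd : t ^ (d * l) - 1 ∣ algebraMap ℚ B p := by
      have h1 : t ^ (d * l) - 1 ∣
          (∑ j ∈ Finset.range p, (t ^ (d * l)) ^ j) - ∑ j ∈ Finset.range p, (1 : B) := by
        rw [← Finset.sum_sub_distrib]
        exact Finset.dvd_sum fun j _ => by simpa using sub_dvd_pow_sub_pow (t ^ (d * l)) 1 j
      rw [h0] at h1
      simpa using h1
    have hp' : IsUnit (algebraMap ℚ B p) :=
      (IsUnit.mk0 (p : ℚ) (by exact_mod_cast hp.ne_zero)).map _
    refine isUnit_of_dvd_unit (dvd_trans ?_ hdvd) hp'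
    have h2 : cyclotomic d ℚ ∣ X ^ (d * l) - 1 :=
      (cyclotomic.dvd_X_pow_sub_one d ℚ).trans (by
        simpa [pow_mul] using sub_dvd_pow_sub_pow ((X : ℚ[X]) ^ d) 1 l)
    simpa using map_dvd (aeval t) h2
  exact hunit.mul_right_eq_zero.1 hprod

open Polynomial in
/-- Every element of `ℚ[ℚ/ℤ]` is a polynomial in `e(1/n)` for some `n > 0`. -/
theorem exists_aeval_single_one_div (x : AddMonoidAlgebra ℚ (AddCircle (1 : ℚ))) :
    ∃ n : ℕ, 0 < n ∧ ∃ f : ℚ[X],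
      x = aeval (AddMonoidAlgebra.single (((1 / (n : ℚ)) : ℚ) : AddCircle (1 : ℚ)) (1 : ℚ)) f := by
  induction x using AddMonoidAlgebra.induction_linear with
  | zero => exact ⟨1, one_pos, 0, by simp⟩
  | add x y hx hy =>
    obtain ⟨n, hn, f, rfl⟩ := hx
    obtain ⟨m, hm, g, rfl⟩ := hy
    have hn' : (n : ℚ) ≠ 0 := by exact_mod_cast hn.ne'
    have hm' : (m : ℚ) ≠ 0 := by exact_mod_cast hm.ne'
    refine ⟨n * m, by positivity, expand ℚ m f + expand ℚ n g, ?_⟩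
    rw [map_add, expand_aeval, expand_aeval, AddMonoidAlgebra.single_pow,
      AddMonoidAlgebra.single_pow, one_pow, one_pow, ← AddCircle.coe_nsmul, ← AddCircle.coe_nsmul]
    congr 5 <;> (rw [nsmul_eq_mul]; push_cast; field_simp)
  | single a r =>
    obtain ⟨q, rfl⟩ := QuotientAddGroup.mk_surjective a
    refine ⟨q.den, q.den_pos, C r * X ^ (q.num % q.den).toNat, ?_⟩
    have hq : (q.den : ℚ) ≠ 0 := by exact_mod_cast q.den_ne_zero
    have hcoe : ((q : ℚ) : AddCircle (1 : ℚ)) =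
        (q.num % q.den).toNat • (((1 / (q.den : ℚ)) : ℚ) : AddCircle (1 : ℚ)) := by
      rw [← AddCircle.coe_nsmul, ← sub_eq_zero, ← AddCircle.coe_sub, AddCircle.coe_eq_zero_iff]
      refine ⟨q.num / q.den, ?_⟩
      have hnonneg : 0 ≤ q.num % q.den := Int.emod_nonneg _ (by exact_mod_cast q.den_ne_zero)
      have hcast : (((q.num % q.den).toNat : ℕ) : ℚ) = ((q.num % q.den : ℤ) : ℚ) := by
        exact_mod_cast Int.toNat_of_nonneg hnonneg
      have hdiv : ((q.num % q.den : ℤ) : ℚ) + q.den * ((q.num / q.den : ℤ) : ℚ) = q.num := by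
        exact_mod_cast Int.emod_add_mul_ediv q.num q.den
      have hmul : q * q.den = q.num := Rat.mul_den_eq_num q
      rw [zsmul_eq_mul, nsmul_eq_mul, hcast]
      field_simp
      linarith
    rw [map_mul, aeval_C, map_pow, aeval_X, AddMonoidAlgebra.single_pow, one_pow, ← hcoe,
      ← Algebra.smul_def, AddMonoidAlgebra.smul_single, smul_eq_mul, mul_one]

theorem single_div_eq_pow (n j : ℕ) :
    AddMonoidAlgebra.single ((((j : ℚ) / (n : ℚ)) : ℚ) : AddCircle (1 : ℚ)) (1 : ℚ) =
      AddMonoidAlgebra.single (((1 / (n : ℚ)) : ℚ) : AddCircle (1 : ℚ)) (1 : ℚ) ^ j := by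
  rw [AddMonoidAlgebra.single_pow, one_pow, ← AddCircle.coe_nsmul, nsmul_eq_mul, mul_one_div]

open Polynomial in
/-- the kernel of `ρ₀ : ℚ[ℚ/ℤ] → ℂ`, `e(γ) ↦ e^{2πiγ}`, is the ideal
generated by the idempotents `π_n = (1/n)∑_{j<n} e(j/n)` (`n ≥ 2`), and the range of
`ρ₀` is the subfield of `ℂ` generated by all roots of unity. -/
theorem stmt12
    (ρ₀ : AddMonoidAlgebra ℚ (AddCircle (1 : ℚ)) →+* ℂ)
    (hρ₀ : ∀ q : ℚ, ρ₀ (AddMonoidAlgebra.single ((q : ℚ) : AddCircle (1 : ℚ)) 1)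
      = Complex.exp (2 * (π : ℂ) * Complex.I * (q : ℂ))) :
    RingHom.ker ρ₀ =
      Ideal.span {x : AddMonoidAlgebra ℚ (AddCircle (1 : ℚ)) | ∃ n : ℕ, 2 ≤ n ∧
        x = (n : ℚ)⁻¹ • ∑ j ∈ Finset.range n,
          AddMonoidAlgebra.single ((((j : ℚ) / (n : ℚ)) : ℚ) : AddCircle (1 : ℚ)) (1 : ℚ)} ∧
    RingHom.range ρ₀ =
      (Subfield.closure {z : ℂ | ∃ n : ℕ, 0 < n ∧ z ^ n = 1}).toSubring := by
  let e : ℕ → AddMonoidAlgebra ℚ (AddCircle (1 : ℚ)) := fun n =>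
    AddMonoidAlgebra.single (((1 / (n : ℚ)) : ℚ) : AddCircle (1 : ℚ)) (1 : ℚ)
  have hprim : ∀ n : ℕ, 0 < n → IsPrimitiveRoot (ρ₀ (e n)) n := by
    intro n hn
    have h := Complex.isPrimitiveRoot_exp n hn.ne'
    rwa [show ρ₀ (e n) = Complex.exp (2 * π * Complex.I / n) by
      simp only [e, hρ₀]; push_cast; rw [mul_one_div]]
  have haeval : ∀ (n : ℕ) (f : ℚ[X]), ρ₀ (aeval (e n) f) = aeval (ρ₀ (e n)) f := fun n f =>
    (aeval_algHom_apply ρ₀.toRatAlgHom (e n) f).symm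
  have hpow : ∀ n : ℕ, 0 < n → e n ^ n = 1 := by
    intro n hn
    have hn' : (n : ℚ) ≠ 0 := by exact_mod_cast hn.ne'
    rw [← single_div_eq_pow, div_self hn', AddCircle.coe_period, AddMonoidAlgebra.one_def]
  refine ⟨le_antisymm ?_ ?_, le_antisymm ?_ ?_⟩
  · intro x hx
    obtain ⟨n, hn, f, rfl⟩ := exists_aeval_single_one_div x
    change aeval (e n) f ∈ _
    have hx : ρ₀ (aeval (e n) f) = 0 := hx
    rw [haeval] at hx
    obtain ⟨g, rfl⟩ : cyclotomic n ℚ ∣ f := by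
      rw [cyclotomic_eq_minpoly_rat (hprim n hn) hn]
      exact minpoly.dvd ℚ _ hx
    rw [map_mul]
    refine Ideal.mul_mem_right _ _ ?_
    rw [← Ideal.Quotient.eq_zero_iff_mem, ← Ideal.Quotient.mkₐ_eq_mk ℚ, ← aeval_algHom_apply]
    refine aeval_cyclotomic_eq_zero_of_sum_pow hn (by rw [← map_pow, hpow n hn, map_one]) ?_
    rintro p m hp rfl
    have hp' : (p : ℚ) ≠ 0 := by exact_mod_cast hp.ne_zero
    have hm' : (m : ℚ) ≠ 0 := by
      rintro h
      simp [Nat.cast_eq_zero.1 h] at hn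
    have hem : e (m * p) ^ m = e p := by
      rw [← single_div_eq_pow]
      congr 2
      push_cast
      field_simp
    simp only [← map_pow, hem, ← map_sum]
    rw [Ideal.Quotient.mkₐ_eq_mk, Ideal.Quotient.eq_zero_iff_mem]
    have hmem := Submodule.smul_of_tower_mem _ (p : ℚ)
      (Ideal.subset_span (α := AddMonoidAlgebra ℚ (AddCircle (1 : ℚ))) (s := {x | ∃ n : ℕ, 2 ≤ n ∧
        x = (n : ℚ)⁻¹ • ∑ j ∈ Finset.range n,
          AddMonoidAlgebra.single ((((j : ℚ) / (n : ℚ)) : ℚ) : AddCircle (1 : ℚ)) (1 : ℚ)})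
        ⟨p, hp.two_le, rfl⟩)
    rw [smul_inv_smul₀ hp'] at hmem
    simpa only [single_div_eq_pow] using hmem
  · rw [Ideal.span_le]
    rintro _ ⟨n, hn, rfl⟩
    change ρ₀.toRatAlgHom _ = 0
    rw [map_smul, map_sum]
    simp only [single_div_eq_pow, map_pow]
    exact smul_eq_zero_of_right _ ((hprim n (by omega)).geom_sum_eq_zero (by omega))
  · rintro _ ⟨x, rfl⟩
    obtain ⟨n, hn, f, rfl⟩ := exists_aeval_single_one_div x
    change ρ₀ (aeval (e n) f) ∈ Subfield.closure _
    rw [haeval, aeval_eq_sum_range]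
    refine sum_mem fun i _ => ?_
    rw [Algebra.smul_def]
    have hroot : ρ₀ (e n) ∈ {z : ℂ | ∃ n : ℕ, 0 < n ∧ z ^ n = 1} :=
      ⟨n, hn, (hprim n hn).pow_eq_one⟩
    exact mul_mem (by simp) (pow_mem (Subfield.subset_closure hroot) _)
  · let K : Subfield ℂ :=
      { ρ₀.range with
        inv_mem' := by
          intro y hy
          have hy' : y ∈ ρ₀.toRatAlgHom.range := hy
          refine Subalgebra.inv_mem_of_algebraic ρ₀.toRatAlgHom.range (x := ⟨y, hy'⟩) ?_
          obtain ⟨x, rfl⟩ := hy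
          obtain ⟨n, hn, f, rfl⟩ := exists_aeval_single_one_div x
          change IsAlgebraic ℚ (ρ₀ (aeval (e n) f))
          rw [haeval]
          have hint : IsIntegral ℚ (ρ₀ (e n)) := ((hprim n hn).isIntegral hn).tower_top
          exact (IsIntegral.of_mem_of_fg _ (hint.fg_adjoin_singleton) _
            (aeval_mem_adjoin_singleton ℚ _)).isAlgebraic }
    change Subfield.closure _ ≤ K
    rw [Subfield.closure_le]
    rintro z ⟨n, hn, hz⟩
    have : NeZero n := ⟨hn.ne'⟩
    obtain ⟨i, -, rfl⟩ := (hprim n hn).eq_pow_of_pow_eq_one hz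
    exact ⟨e n ^ i, map_pow _ _ _⟩
end

section
/- Let p be a prime, k an algebraic closure of 𝔽_p, and W = W(k) the ring of p-typical Witt vectors of k. The zeroth-coefficient (residue) map W → k, x ↦ x₀, is a ring homomorphism and induces a group homomorphism W^× → k^× on unit groups. Then the map sending a group homomorphism ρ : ℚ/ℤ → W^× to its composition with the induced map W^× → k^× is a bijection from Hom(ℚ/ℤ, W^×) onto Hom(ℚ/ℤ, k^×). -/
/-- If two Witt vectors over a perfect ring agree in the zeroth coefficient, then their
`p ^ n`-th powers are congruent modulo `p ^ (n + 1)`. -/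
theorem WittVector.p_pow_dvd_pow_sub_pow {p : ℕ} [Fact p.Prime] {k : Type*} [CommRing k]
    [CharP k p] [PerfectRing k p] {x y : WittVector p k} (h : x.coeff 0 = y.coeff 0) (n : ℕ) :
    (p : WittVector p k) ^ (n + 1) ∣ x ^ p ^ n - y ^ p ^ n := by
  refine dvd_sub_pow_of_dvd_sub ?_ n
  rw [← Ideal.mem_span_singleton, WittVector.mem_span_p_iff_coeff_zero_eq_zero]
  change WittVector.constantCoeff (x - y) = 0
  rw [map_sub, sub_eq_zero]
  exact h

/-- A Witt vector over a perfect ring that is divisible by every power of `p` vanishes. -/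
theorem WittVector.eq_zero_of_forall_p_pow_dvd {p : ℕ} [Fact p.Prime] {k : Type*} [CommRing k]
    [CharP k p] [PerfectRing k p] {x : WittVector p k}
    (h : ∀ n : ℕ, (p : WittVector p k) ^ (n + 1) ∣ x) : x = 0 := by
  ext m
  have hm := h m
  rw [← Ideal.mem_span_singleton, WittVector.mem_span_p_pow_iff_le_coeff_eq_zero] at hm
  simpa using hm m (Nat.lt_succ_self m)

/-- A homomorphism from a `p`-divisible group to the units of `W(k)` is determined by its
reduction. -/
theorem WittVector.monoidHom_units_ext {p : ℕ} [Fact p.Prime] {k : Type*} [CommRing k]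
    [CharP k p] [PerfectRing k p] {G : Type*} [Monoid G]
    (hG : ∀ (n : ℕ) (g : G), ∃ g' : G, g' ^ p ^ n = g) {ρ σ : G →* (WittVector p k)ˣ}
    (h : ∀ g, (ρ g : WittVector p k).coeff 0 = (σ g : WittVector p k).coeff 0) : ρ = σ := by
  ext1 g
  apply Units.ext
  rw [← sub_eq_zero]
  refine WittVector.eq_zero_of_forall_p_pow_dvd fun n => ?_
  obtain ⟨g', rfl⟩ := hG n g
  simpa only [map_pow, Units.val_pow_eq_pow_val] using
    WittVector.p_pow_dvd_pow_sub_pow (h g') n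

/-- The group `ℚ/ℤ`, written multiplicatively, has `n`-th roots for `n ≠ 0`. -/
theorem AddCircle.exists_pow_eq_of_rat {n : ℕ} (hn : n ≠ 0)
    (g : Multiplicative (AddCircle (1 : ℚ))) :
    ∃ g' : Multiplicative (AddCircle (1 : ℚ)), g' ^ n = g := by
  obtain ⟨q, hq⟩ := QuotientAddGroup.mk_surjective g.toAdd
  refine ⟨Multiplicative.ofAdd ((q / n : ℚ) : AddCircle (1 : ℚ)), ?_⟩
  rw [← ofAdd_nsmul, ← AddCircle.coe_nsmul, nsmul_eq_mul,
    mul_div_cancel₀ q (Nat.cast_ne_zero.mpr hn)]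
  exact congrArg Multiplicative.ofAdd hq

/-- for `k = 𝔽̄_p` and `W = W(k)` the `p`-typical Witt vectors, the
zeroth-coefficient map `W → k` is a ring homomorphism, and composition with the induced
map `W^× → k^×` is a bijection `Hom(ℚ/ℤ, W^×) → Hom(ℚ/ℤ, k^×)`. -/
theorem stmt18 (p : ℕ) [Fact p.Prime] (k : Type) [Field k] [Algebra (ZMod p) k]
    [IsAlgClosure (ZMod p) k] :
    ∃ f : WittVector p k →+* k,
      (∀ x : WittVector p k, f x = x.coeff 0) ∧
      Function.Bijective
        (fun ρ : Multiplicative (AddCircle (1 : ℚ)) →* (WittVector p k)ˣ =>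
          (Units.map f.toMonoidHom).comp ρ) := by
  have : CharP k p := charP_of_injective_algebraMap (algebraMap (ZMod p) k).injective p
  have : IsAlgClosed k := IsAlgClosure.isAlgClosed (ZMod p)
  refine ⟨WittVector.constantCoeff, fun x => rfl, fun ρ σ h => ?_, fun σ => ?_⟩
  · refine WittVector.monoidHom_units_ext (fun n g => AddCircle.exists_pow_eq_of_rat
      (pow_ne_zero n (Fact.out : p.Prime).ne_zero) g) fun g => ?_
    exact congrArg Units.val (DFunLike.congr_fun h g)
  · refine ⟨(Units.map (WittVector.teichmuller p)).comp σ, ?_⟩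
    ext g
    exact WittVector.teichmuller_coeff_zero p _
end

section
/- Let p be a prime and n ≥ 1 an integer. Let R_n = 𝔽_p[x₀, x₁, …, x_{n−1}] be the polynomial ring in n variables over 𝔽_p, and let x be the truncated p-typical Witt vector of length n over R_n whose components are x₀, …, x_{n−1}. Let J_n ⊂ R_n be the ideal generated by the n components of the Witt vector F(x) − x − 1, where F is the Frobenius of Witt vectors (which, in characteristic p, raises each component to the p-th power). Then J_n is a prime ideal, and the quotient R_n/J_n is a finite field with p^{p^n} elements, i.e., R_n/J_n ≅ 𝔽_{p^{p^n}}. -/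
open scoped BigOperators

namespace TruncatedWittVector

variable {p : ℕ} [Fact p.Prime] {n : ℕ} {R S T : Type*} [CommRing R] [CommRing S] [CommRing T]

/-- The ring homomorphism of truncated Witt vectors applying `f` to every component. -/
noncomputable def map (f : R →+* S) : TruncatedWittVector p n R →+* TruncatedWittVector p n S :=
  (WittVector.truncate n).liftOfSurjective (WittVector.truncate_surjective p n R)
    ⟨(WittVector.truncate n).comp (WittVector.map f), fun x hx => by
      rw [WittVector.mem_ker_truncate] at hx
      rw [RingHom.mem_ker]
      ext i
      simp [WittVector.coeff_truncate, hx i i.2]⟩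

theorem map_truncate (f : R →+* S) (x : WittVector p R) :
    map f (WittVector.truncate n x) = WittVector.truncate n (WittVector.map f x) :=
  RingHom.liftOfSurjective_comp_apply ..

@[simp]
theorem coeff_map (f : R →+* S) (x : TruncatedWittVector p n R) (i : Fin n) :
    (map f x).coeff i = f (x.coeff i) := by
  obtain ⟨x, rfl⟩ := WittVector.truncate_surjective p n R x
  simp [map_truncate, WittVector.coeff_truncate]

theorem map_injective {f : R →+* S} (hf : Function.Injective f) :
    Function.Injective (map (p := p) (n := n) f) := fun x y h => by
  ext i
  exact hf (by simpa using congrArg (coeff i) h)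

theorem natCast_eq_zero_iff [CharP R p] [Nontrivial R] (d : ℕ) :
    (d : TruncatedWittVector p n R) = 0 ↔ p ^ n ∣ d := by
  have := charP_zmod p n
  rw [← CharP.cast_eq_zero_iff (TruncatedWittVector p n (ZMod p)) (p ^ n),
    ← map_eq_zero_iff (map (ZMod.castHom dvd_rfl R)) (map_injective (RingHom.injective _)),
    map_natCast]

theorem coeff_iterate_map_frobenius [CharP R p] (x : TruncatedWittVector p n R) (k : ℕ)
    (i : Fin n) : ((map (frobenius R p))^[k] x).coeff i = x.coeff i ^ p ^ k := by
  induction k with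
  | zero => simp
  | succ k ih => rw [Function.iterate_succ_apply', coeff_map, ih, frobenius_def, ← pow_mul, pow_succ]

theorem map_frobenius_comm [CharP R p] [CharP S p] (f : R →+* S)
    (x : TruncatedWittVector p n R) :
    map f (map (frobenius R p) x) = map (frobenius S p) (map f x) := by
  ext i
  simp [frobenius_def]

theorem iterate_map_frobenius_of_eq_add_one [CharP R p] {x : TruncatedWittVector p n R}
    (hx : map (frobenius R p) x = x + 1) (k : ℕ) :
    (map (frobenius R p))^[k] x = x + k := by
  induction k with
  | zero => simp
  | succ k ih =>
    rw [Function.iterate_succ_apply', ih, map_add, hx, map_natCast]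
    push_cast
    ring

theorem exists_natCast_eq_of_map_frobenius_eq_self {K : Type*} [Field K] [CharP K p]
    {x : TruncatedWittVector p n K} (hx : map (frobenius K p) x = x) :
    ∃ k : ℕ, x = k := by
  have h (i : Fin n) : ∃ a : ZMod p, ZMod.castHom dvd_rfl K a = x.coeff i := by
    have hi : x.coeff i ∈ (⊥ : Subfield K) := by
      rw [Subfield.mem_bot_iff_pow_eq_self (p := p) (F := K)]
      simpa [frobenius_def] using congrArg (coeff i) hx
    have hle : (⊥ : Subfield K) ≤ (ZMod.castHom dvd_rfl K : ZMod p →+* K).fieldRange := bot_le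
    exact hle hi
  choose a ha using h
  obtain ⟨b, hb⟩ := (zmodEquivTrunc p n).surjective (mk p a)
  have : NeZero (p ^ n) := ⟨pow_ne_zero _ (Fact.out : p.Prime).ne_zero⟩
  refine ⟨b.val, ?_⟩
  rw [← map_natCast (map (ZMod.castHom dvd_rfl K)), ← map_natCast (zmodEquivTrunc p n),
    ZMod.natCast_zmod_val, hb]
  ext i
  simp [ha]

/-- Additive Hilbert 90 for the element `1`. -/
theorem _root_.RingHom.exists_map_eq_add_one {B : Type*} [CommRing B] (σ : B →+* B) (N : ℕ)
    (hN : (N : B) = 0) {w : B} (hw : σ^[N] w = w)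
    (hu : IsUnit (∑ i ∈ Finset.range N, σ^[i] w)) : ∃ x, σ x = x + 1 := by
  obtain ⟨u, hu⟩ := hu
  have hσu : σ u = u := by
    have := Finset.sum_range_succ' (fun i => σ^[i] w) N
    rw [Finset.sum_range_succ, hw, Function.iterate_zero_apply, add_left_inj] at this
    rw [hu, map_sum]
    simp only [← Function.iterate_succ_apply' (⇑σ)]
    exact this.symm
  have hσv : σ ↑u⁻¹ = (↑u⁻¹ : B) := by
    apply u.isUnit.mul_left_cancel
    nth_rw 1 [← hσu]
    rw [← map_mul, Units.mul_inv, map_one]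
  have key : σ (∑ i ∈ Finset.range N, (i : B) * σ^[i] w) =
      ∑ i ∈ Finset.range N, (i : B) * σ^[i] w - u := by
    have := Finset.sum_range_succ' (fun i => (i : B) * σ^[i] w) N
    rw [Finset.sum_range_succ, hN] at this
    simp only [zero_mul, add_zero, Nat.cast_zero, Nat.cast_succ, add_mul, one_mul,
      Function.iterate_succ_apply', Finset.sum_add_distrib] at this
    rw [map_sum, this]
    simp only [map_mul, map_natCast]
    rw [← hσu, hu, map_sum]
    ring
  refine ⟨-(∑ i ∈ Finset.range N, (i : B) * σ^[i] w) * ↑u⁻¹, ?_⟩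
  rw [map_mul, map_neg, key, hσv]
  linear_combination Units.mul_inv u

theorem exists_map_frobenius_eq_add_one {K : Type*} [Field K] [Finite K] [CharP K p]
    (hK : Nat.card K = p ^ p ^ n) :
    ∃ x : TruncatedWittVector p n K, map (frobenius K p) x = x + 1 := by
  have hpow (a : K) : a ^ p ^ p ^ n = a := by
    have := Fintype.ofFinite K
    rw [← hK, Nat.card_eq_fintype_card, FiniteField.pow_card]
  let := ZMod.algebra K p
  obtain ⟨t, ht⟩ : ∃ t : K, ∑ i ∈ Finset.range (p ^ n), t ^ p ^ i ≠ 0 := by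
    have hfin : Module.finrank (ZMod p) K = p ^ n :=
      Nat.pow_right_injective (Fact.out : p.Prime).two_le
        (by simpa [hK] using FiniteField.pow_finrank_eq_natCard p K)
    obtain ⟨t, ht⟩ := Algebra.trace_surjective (ZMod p) K 1
    refine ⟨t, ?_⟩
    have := FiniteField.algebraMap_trace_eq_sum_pow (ZMod p) K t
    rw [hfin, ht, map_one, Nat.card_zmod] at this
    simp [← this]
  have hcoeff (k : ℕ) (j : ℕ) : ((WittVector.frobenius)^[k] (WittVector.teichmuller p t)).coeff j =
      (WittVector.teichmuller p t).coeff j ^ p ^ k := WittVector.iterate_frobenius_coeff ..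
  have hunit : IsUnit (∑ i ∈ Finset.range (p ^ n),
      WittVector.frobenius^[i] (WittVector.teichmuller p t)) := by
    apply WittVector.isUnit_of_coeff_zero_ne_zero
    rw [← WittVector.constantCoeff_apply, map_sum]
    simpa [WittVector.constantCoeff_apply, hcoeff] using ht
  have htr (k : ℕ) : (map (frobenius K p))^[k] (WittVector.truncate n (WittVector.teichmuller p t))
      = WittVector.truncate n (WittVector.frobenius^[k] (WittVector.teichmuller p t)) := by
    ext i
    simp [coeff_iterate_map_frobenius, WittVector.coeff_truncate, hcoeff]
  refine RingHom.exists_map_eq_add_one (map (frobenius K p)) (p ^ n)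
    (w := WittVector.truncate n (WittVector.teichmuller p t))
    ((natCast_eq_zero_iff _).2 dvd_rfl) ?_ ?_
  · ext i
    rw [coeff_iterate_map_frobenius, hpow]
  · simp only [htr, ← map_sum]
    exact hunit.map _

/-- The ideal generated by the components of `F x - x - 1`, for `x` the generic truncated Witt
vector. -/
noncomputable def artinSchreierIdeal (p n : ℕ) [Fact p.Prime] :
    Ideal (MvPolynomial (Fin n) (ZMod p)) :=
  Ideal.span (Set.range fun i : Fin n =>
    ((mk p fun j : Fin n => (MvPolynomial.X j : MvPolynomial (Fin n) (ZMod p)) ^ p)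
      - mk p (fun j : Fin n => (MvPolynomial.X j : MvPolynomial (Fin n) (ZMod p))) - 1).coeff i)

theorem artinSchreierIdeal_le_ker_iff [CharP S p] (f : MvPolynomial (Fin n) (ZMod p) →+* S) :
    artinSchreierIdeal p n ≤ RingHom.ker f ↔
      map (frobenius S p) (mk p fun j => f (.X j)) = (mk p fun j => f (.X j)) + 1 := by
  have hX : (mk p fun j => f (.X j)) = map f (mk p .X) := by ext; simp
  have hXp : (mk p fun j : Fin n => (MvPolynomial.X j : MvPolynomial (Fin n) (ZMod p)) ^ p) =
      map (frobenius _ p) (mk p .X) := by ext; simp [frobenius_def]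
  rw [artinSchreierIdeal, Ideal.span_le, hX, ← map_frobenius_comm, ← hXp,
    ← sub_eq_zero, ← sub_sub, ← map_sub, ← map_one (map f), ← map_sub,
    TruncatedWittVector.ext_iff, Set.range_subset_iff]
  simp only [coeff_map, coeff_zero, SetLike.mem_coe, RingHom.mem_ker]

theorem pow_eq_self_of_artinSchreierIdeal_le_ker [CharP S p]
    {f : MvPolynomial (Fin n) (ZMod p) →+* S} (hf : artinSchreierIdeal p n ≤ RingHom.ker f)
    (a : MvPolynomial (Fin n) (ZMod p)) : f a ^ p ^ p ^ n = f a := by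
  nontriviality S
  have h : (iterateFrobenius S p (p ^ n)).comp f = f := by
    refine MvPolynomial.ringHom_ext (fun c => ?_) fun i => ?_
    · rw [RingHom.comp_apply, iterateFrobenius_def, ← map_pow, ← map_pow, ZMod.pow_card_pow]
    · have := iterate_map_frobenius_of_eq_add_one ((artinSchreierIdeal_le_ker_iff f).1 hf) (p ^ n)
      rw [(natCast_eq_zero_iff _).2 dvd_rfl, add_zero] at this
      simpa [coeff_iterate_map_frobenius, iterateFrobenius_def] using congrArg (coeff i) this
  exact congrArg (· a) h

theorem ker_le_ker_of_artinSchreierIdeal_le_ker {K : Type*} [Field K] [CharP K p]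
    {f g : MvPolynomial (Fin n) (ZMod p) →+* K} (hf : artinSchreierIdeal p n ≤ RingHom.ker f)
    (hg : artinSchreierIdeal p n ≤ RingHom.ker g) : RingHom.ker f ≤ RingHom.ker g := by
  rw [artinSchreierIdeal_le_ker_iff] at hf hg
  obtain ⟨k, hk⟩ := exists_natCast_eq_of_map_frobenius_eq_self (p := p) (n := n)
    (x := (mk p fun j => g (.X j)) - mk p fun j => f (.X j)) (by rw [map_sub, hf, hg]; ring)
  have h : (iterateFrobenius K p k).comp f = g := by
    refine MvPolynomial.ringHom_ext (fun c => ?_) fun i => ?_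
    · rw [RingHom.comp_apply, iterateFrobenius_def, ← map_pow, ← map_pow, ZMod.pow_card_pow]
      exact RingHom.congr_fun (Subsingleton.elim (f.comp MvPolynomial.C) (g.comp MvPolynomial.C)) c
    · have := iterate_map_frobenius_of_eq_add_one hf k
      rw [← hk, add_sub_cancel] at this
      simpa [coeff_iterate_map_frobenius, iterateFrobenius_def] using congrArg (coeff i) this
  intro a ha
  rw [RingHom.mem_ker] at ha ⊢
  rw [← h, RingHom.comp_apply, ha, map_zero]

theorem _root_.Ideal.exists_isMaximal_le_notMem_of_pow_sub_mem {J : Ideal R} {a : R} (ha : a ∉ J)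
    {q : ℕ} (hq : 1 < q) (h : a ^ q - a ∈ J) : ∃ M : Ideal R, M.IsMaximal ∧ J ≤ M ∧ a ∉ M := by
  have hne : J ⊔ Ideal.span {1 - a ^ (q - 1)} ≠ ⊤ := fun htop => by
    obtain ⟨b, hb, c, hc, hbc⟩ := Submodule.mem_sup.1 ((Ideal.eq_top_iff_one _).1 htop)
    obtain ⟨d, rfl⟩ := Ideal.mem_span_singleton.1 hc
    have haq : a ^ q = a * a ^ (q - 1) := by rw [← pow_succ', Nat.sub_add_cancel hq.le]
    have : a = a * b - d * (a ^ q - a) := by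
      rw [haq]
      linear_combination -a * hbc
    exact ha (this ▸ J.sub_mem (J.mul_mem_left a hb) (J.mul_mem_left d h))
  obtain ⟨M, hM, hle⟩ := Ideal.exists_le_maximal _ hne
  refine ⟨M, hM, le_sup_left.trans hle, fun haM => hM.ne_top <| (Ideal.eq_top_iff_one M).2 ?_⟩
  have hmem : 1 - a ^ (q - 1) ∈ M := hle (Ideal.mem_sup_right (Ideal.mem_span_singleton_self _))
  simpa using M.add_mem hmem (Ideal.pow_mem_of_mem M haM _ (Nat.sub_pos_of_lt hq))

theorem _root_.IsAlgClosed.exists_ringHom_of_forall_pow_eq {K L : Type*} [Field K] [IsAlgClosed K]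
    [CharP K p] [Field L] [CharP L p] {q : ℕ} (hq : 1 < q) (h : ∀ x : L, x ^ q = x) :
    Nonempty (L →+* K) := by
  let := ZMod.algebra K p
  let := ZMod.algebra L p
  have hne : (.X ^ q - .X : Polynomial (ZMod p)) ≠ 0 :=
    FiniteField.X_pow_card_sub_X_ne_zero (ZMod p) hq
  have : Algebra.IsAlgebraic (ZMod p) L := ⟨fun x =>
    ⟨_, hne, by simp only [map_sub, map_pow, Polynomial.aeval_X, h, sub_self]⟩⟩
  exact ⟨(IsAlgClosed.lift : L →ₐ[ZMod p] K).toRingHom⟩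

theorem ker_eq_artinSchreierIdeal {K : Type*} [Field K] [IsAlgClosed K] [CharP K p]
    {f : MvPolynomial (Fin n) (ZMod p) →+* K} (hf : artinSchreierIdeal p n ≤ RingHom.ker f) :
    RingHom.ker f = artinSchreierIdeal p n := by
  refine le_antisymm (fun a ha => ?_) hf
  by_contra haJ
  have hq : 1 < p ^ p ^ n :=
    Nat.one_lt_pow (pow_ne_zero _ (Fact.out : p.Prime).ne_zero) (Fact.out : p.Prime).one_lt
  have hpow : a ^ p ^ p ^ n - a ∈ artinSchreierIdeal p n := by
    have : Nontrivial (MvPolynomial (Fin n) (ZMod p) ⧸ artinSchreierIdeal p n) :=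
      Ideal.Quotient.nontrivial_iff.2 fun h => haJ (h ▸ Submodule.mem_top)
    have : CharP (MvPolynomial (Fin n) (ZMod p) ⧸ artinSchreierIdeal p n) p :=
      charP_of_injective_algebraMap (algebraMap (ZMod p) _).injective p
    rw [← Ideal.Quotient.mk_eq_mk_iff_sub_mem, map_pow]
    exact pow_eq_self_of_artinSchreierIdeal_le_ker Ideal.mk_ker.ge a
  obtain ⟨M, hM, hJM, haM⟩ := Ideal.exists_isMaximal_le_notMem_of_pow_sub_mem haJ hq hpow
  have : CharP (MvPolynomial (Fin n) (ZMod p) ⧸ M) p :=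
    charP_of_injective_algebraMap (algebraMap (ZMod p) _).injective p
  have hpowM (x : MvPolynomial (Fin n) (ZMod p) ⧸ M) : x ^ p ^ p ^ n = x := by
    obtain ⟨b, rfl⟩ := Ideal.Quotient.mk_surjective x
    exact pow_eq_self_of_artinSchreierIdeal_le_ker (hJM.trans Ideal.mk_ker.ge) b
  let := Ideal.Quotient.field M
  obtain ⟨g⟩ := IsAlgClosed.exists_ringHom_of_forall_pow_eq (p := p) (K := K) hq hpowM
  have hg : RingHom.ker (g.comp (Ideal.Quotient.mk M)) = M := by
    rw [RingHom.ker_comp_of_injective _ (RingHom.injective _), Ideal.mk_ker]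
  have := ker_le_ker_of_artinSchreierIdeal_le_ker hf (hJM.trans hg.ge) ha
  exact haM (hg.le this)

theorem exists_ringHom_ker_eq_artinSchreierIdeal {K : Type*} [Field K] [Finite K] [CharP K p]
    (hK : Nat.card K = p ^ p ^ n) :
    ∃ f : MvPolynomial (Fin n) (ZMod p) →+* K, RingHom.ker f = artinSchreierIdeal p n := by
  obtain ⟨x, hx⟩ := exists_map_frobenius_eq_add_one (n := n) hK
  let f : MvPolynomial (Fin n) (ZMod p) →+* K :=
    MvPolynomial.eval₂Hom (ZMod.castHom dvd_rfl K) fun i => x.coeff i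
  have hf : artinSchreierIdeal p n ≤ RingHom.ker f := by
    rw [artinSchreierIdeal_le_ker_iff]
    simpa [f] using hx
  have : CharP (AlgebraicClosure K) p :=
    charP_of_injective_algebraMap (algebraMap K _).injective p
  have hker : RingHom.ker ((algebraMap K (AlgebraicClosure K)).comp f) = RingHom.ker f :=
    RingHom.ker_comp_of_injective _ (RingHom.injective _)
  exact ⟨f, hker ▸ ker_eq_artinSchreierIdeal (hker ▸ hf)⟩

theorem isField_and_card_quotient_artinSchreierIdeal :
    IsField (MvPolynomial (Fin n) (ZMod p) ⧸ artinSchreierIdeal p n) ∧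
      Nat.card (MvPolynomial (Fin n) (ZMod p) ⧸ artinSchreierIdeal p n) = p ^ p ^ n := by
  have hp := (Fact.out : p.Prime)
  have hN : p ^ n ≠ 0 := pow_ne_zero _ hp.ne_zero
  have hK := GaloisField.card p (p ^ n) hN
  have : Finite (GaloisField p (p ^ n)) :=
    Nat.finite_of_card_ne_zero (hK ▸ pow_ne_zero _ hp.ne_zero)
  obtain ⟨f, hf⟩ := exists_ringHom_ker_eq_artinSchreierIdeal hK
  set A := MvPolynomial (Fin n) (ZMod p) ⧸ artinSchreierIdeal p n
  have : (artinSchreierIdeal p n).IsPrime := hf ▸ RingHom.ker_isPrime f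
  let F : A →+* GaloisField p (p ^ n) := Ideal.Quotient.lift _ f fun a ha => by
    rwa [← hf, RingHom.mem_ker] at ha
  have hF : Function.Injective F := RingHom.lift_injective_of_ker_le_ideal _ _ hf.le
  have : Finite A := .of_injective F hF
  have hA : IsField A := Finite.isField_of_domain A
  refine ⟨hA, ?_⟩
  let := hA.toField
  have : CharP A p := charP_of_injective_algebraMap (algebraMap (ZMod p) A).injective p
  have hcard := FiniteField.pow_finrank_eq_natCard p A
  have hle : Module.finrank (ZMod p) A ≤ p ^ n := by
    rw [← Nat.pow_le_pow_iff_right hp.one_lt, hcard, ← hK]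
    exact Nat.card_le_card_of_injective F hF
  have hx := iterate_map_frobenius_of_eq_add_one
    ((artinSchreierIdeal_le_ker_iff (Ideal.Quotient.mk (artinSchreierIdeal p n))).1
      (by rw [Ideal.mk_ker])) (Module.finrank (ZMod p) A)
  have hdvd : p ^ n ∣ Module.finrank (ZMod p) A := by
    rw [← natCast_eq_zero_iff (R := A) (p := p), ← add_eq_left, ← hx]
    ext i
    have := Fintype.ofFinite A
    rw [coeff_iterate_map_frobenius, hcard, Nat.card_eq_fintype_card, FiniteField.pow_card]
  rw [← hcard, hle.antisymm (Nat.le_of_dvd Module.finrank_pos hdvd)]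

end TruncatedWittVector

/-- Witt's construction of `𝔽_{p^{p^n}}`: let
`R_n = 𝔽_p[x₀,…,x_{n−1}]`, let `x` be the length-`n` truncated Witt vector with
components the variables `xᵢ`, and let `J_n` be the ideal generated by the components
of `F(x) − x − 1`, where `F` raises each component to the `p`-th power. Then `J_n` is
prime and `R_n/J_n` is a finite field with `p^{p^n}` elements. -/
theorem stmt19 (p : ℕ) [Fact p.Prime] (n : ℕ) (hn : 1 ≤ n) :
    (Ideal.span (Set.range fun i : Fin n =>
        ((TruncatedWittVector.mk p fun j : Fin n =>
            (MvPolynomial.X j : MvPolynomial (Fin n) (ZMod p)) ^ p)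
          - TruncatedWittVector.mk p (fun j : Fin n =>
            (MvPolynomial.X j : MvPolynomial (Fin n) (ZMod p)))
          - 1).coeff i)).IsPrime ∧
    IsField (MvPolynomial (Fin n) (ZMod p) ⧸
      Ideal.span (Set.range fun i : Fin n =>
        ((TruncatedWittVector.mk p fun j : Fin n =>
            (MvPolynomial.X j : MvPolynomial (Fin n) (ZMod p)) ^ p)
          - TruncatedWittVector.mk p (fun j : Fin n =>
            (MvPolynomial.X j : MvPolynomial (Fin n) (ZMod p)))
          - 1).coeff i)) ∧
    Nat.card (MvPolynomial (Fin n) (ZMod p) ⧸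
      Ideal.span (Set.range fun i : Fin n =>
        ((TruncatedWittVector.mk p fun j : Fin n =>
            (MvPolynomial.X j : MvPolynomial (Fin n) (ZMod p)) ^ p)
          - TruncatedWittVector.mk p (fun j : Fin n =>
            (MvPolynomial.X j : MvPolynomial (Fin n) (ZMod p)))
          - 1).coeff i)) = p ^ (p ^ n) := by
  have h := TruncatedWittVector.isField_and_card_quotient_artinSchreierIdeal (p := p) (n := n)
  exact ⟨(Ideal.Quotient.maximal_of_isField _ h.1).isPrime, h⟩
end
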